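/- Let n > 2k ≥ 10 and let F be an intersecting family of k-element subsets of [n] with |F| = |J_3|, and suppose there do NOT exist an element i ∈ [n] and a (k−1)-set K ⊆ [n]∖{i} such that every member of F contains i or contains K (i.e., F is not contained in any E_l). Then: if n ≥ 2k+2, F is isomorphic to J_3; if n = 2k+1, F is isomorphic to J_i for some i with 3 ≤ i ≤ k. -/

import Mathlib

/-- A family is intersecting if any two of its members intersect. -/
def Intersecting (F : Finset (Finset ℕ)) : Prop :=
  ∀ A ∈ F, ∀ B ∈ F, (A ∩ B).Nonempty

/-- `I_i = [i+1, k+i]`. -/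
def Iset (k i : ℕ) : Finset ℕ := Finset.Icc (i + 1) (k + i)

/-- The family `J_i = {I_1, I_i} ∪ {F ∈ C([n],k) : 1 ∈ F, F ∩ I_1 ≠ ∅, F ∩ I_i ≠ ∅}`. -/
def Jfam (n k i : ℕ) : Finset (Finset ℕ) :=
  {Iset k 1, Iset k i} ∪
    (Finset.powersetCard k (Finset.Icc 1 n)).filter
      (fun A => 1 ∈ A ∧ (A ∩ Iset k 1).Nonempty ∧ (A ∩ Iset k i).Nonempty)

/-- Two families are isomorphic if some permutation of `[n]` maps one onto the other. -/
def Isomorphic (n : ℕ) (F G : Finset (Finset ℕ)) : Prop :=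
  ∃ σ : Equiv.Perm ℕ, (∀ x ∈ Finset.Icc 1 n, σ x ∈ Finset.Icc 1 n) ∧
    F.image (fun A => A.image σ) = G


/-- all `q`-subsets of members of the family -/
def shq (q : ℕ) (G : Finset (Finset ℕ)) : Finset (Finset ℕ) := G.biUnion (Finset.powersetCard q)

theorem mem_shq {q : ℕ} {G : Finset (Finset ℕ)} {Y : Finset ℕ} :
    Y ∈ shq q G ↔ ∃ X ∈ G, Y ⊆ X ∧ Y.card = q := by
  simp [shq, Finset.mem_powersetCard]

theorem shq_mono {q : ℕ} {G H : Finset (Finset ℕ)} (h : G ⊆ H) : shq q G ⊆ shq q H := by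
  intro Y hY
  rw [mem_shq] at *
  obtain ⟨X, hX, h1⟩ := hY
  exact ⟨X, h hX, h1⟩

open Finset.Colex in
theorem exists_initSeg_card (n r t : ℕ) (ht : t ≤ n.choose r) :
    ∃ C : Finset (Finset (Fin n)), IsInitSeg C r ∧ C.card = t := by
  induction t with
  | zero => exact ⟨∅, by simp, by simp⟩
  | succ t ih =>
    obtain ⟨C, hC, hct⟩ := ih (by omega)
    have hne : ((Finset.powersetCard r (Finset.univ : Finset (Fin n))) \ C).Nonempty := by
      rw [← Finset.card_pos]
      have := Finset.le_card_sdiff C (Finset.powersetCard r (Finset.univ : Finset (Fin n)))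
      simp at this
      omega
    obtain ⟨s, hs, hmin⟩ := Finset.exists_min_image _ (fun s => toColex s) hne
    rw [Finset.mem_sdiff, Finset.mem_powersetCard] at hs
    refine ⟨insert s C, ⟨?_, ?_⟩, ?_⟩
    · intro x hx
      rw [Finset.mem_coe, Finset.mem_insert] at hx
      rcases hx with rfl | hx
      · exact hs.1.2
      · exact hC.1 hx
    · intro a b ha hb
      rw [Finset.mem_insert] at ha ⊢
      rcases ha with rfl | ha
      · by_contra hcon
        push Not at hcon
        have := hmin b (by simp [Finset.mem_sdiff, Finset.mem_powersetCard, hcon.2, hb.2])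
        exact absurd hb.1 (not_lt.2 this)
      · exact Or.inr (hC.2 ha hb)
    · rw [Finset.card_insert_of_notMem hs.2, hct]

open Finset.Colex in
theorem isInitSeg_range (n r k : ℕ) :
    IsInitSeg (Finset.powersetCard r (Finset.univ.filter (fun x : Fin n => x.val < k))) r := by
  refine ⟨Set.sized_powersetCard _ _, ?_⟩
  rintro A B hA ⟨hB, hB'⟩
  rw [Finset.mem_powersetCard] at hA ⊢
  refine ⟨fun t ht => ?_, hB'⟩
  rw [Finset.mem_filter]
  refine ⟨Finset.mem_univ _, ?_⟩
  rw [toColex_lt_toColex] at hB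
  by_contra hcon
  have htA : t ∉ A := fun h => hcon (by simpa using hA.1 h)
  obtain ⟨b, hb, hbB, htb⟩ := hB.2 ht htA
  have : b.val < k := by simpa using hA.1 hb
  have : t.val ≤ b.val := htb
  omega

open FinsetFamily in
open Finset.Colex in
/-- Kruskal Katona, transferred to families of finite sets of naturals. -/
theorem kk_init (G : Finset (Finset ℕ)) (r N : ℕ) (hr : ∀ X ∈ G, X.card = r)
    (hN : G.card ≤ N.choose r) :
    ∃ C : Finset (Finset ℕ), C ⊆ Finset.powersetCard r (Finset.range N) ∧ C.card = G.card ∧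
      (∀ q, q ≤ r → (shq q C).card ≤ (shq q G).card) ∧
      (∀ M, M ≤ N → M.choose r ≤ C.card → Finset.powersetCard r (Finset.range M) ⊆ C) := by
  classical
  obtain ⟨n, hNn, hGn⟩ : ∃ n, N ≤ n ∧ ∀ X ∈ G, ∀ x ∈ X, x < n := by
    refine ⟨N + (G.biUnion id).sup (fun x => x + 1), by omega, fun X hX x hx => ?_⟩
    have : x + 1 ≤ (G.biUnion id).sup (fun x => x + 1) :=
      Finset.le_sup (f := fun x => x + 1) (by simp; exact ⟨X, hX, hx⟩)
    omega
  let up : Finset (Fin n) ↪ Finset ℕ := (Finset.mapEmbedding Fin.valEmbedding).toEmbedding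
  have up_apply : ∀ s, up s = s.map Fin.valEmbedding := fun s => rfl
  have up_mem : ∀ (s : Finset (Fin n)) x, x ∈ up s ↔ ∃ h : x < n, (⟨x, h⟩ : Fin n) ∈ s := by
    intro s x
    rw [up_apply, Finset.mem_map]
    constructor
    · rintro ⟨a, ha, rfl⟩; exact ⟨a.2, ha⟩
    · rintro ⟨h, h'⟩; exact ⟨_, h', rfl⟩
  have up_card : ∀ s, (up s).card = s.card := fun s => by rw [up_apply, Finset.card_map]
  have up_sub : ∀ s t, up s ⊆ up t ↔ s ⊆ t := fun s t => by
    rw [up_apply, up_apply, Finset.map_subset_map]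
  have up_surj : ∀ X : Finset ℕ, (∀ x ∈ X, x < n) → ∃ s, up s = X := by
    intro X hX
    refine ⟨Finset.univ.filter (fun x : Fin n => x.val ∈ X), ?_⟩
    ext x
    rw [up_mem]
    constructor
    · rintro ⟨h, h'⟩; simpa using h'
    · intro hx; exact ⟨hX x hx, by simpa using hx⟩
  have sh_up : ∀ (D : Finset (Finset (Fin n))) q, q ≤ r → (D : Set (Finset (Fin n))).Sized r →
      shq q (D.map up) = (∂^[r - q] D).map up := by
    intro D q hq hD
    ext Y
    rw [mem_shq, Finset.mem_map]
    constructor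
    · rintro ⟨X, hX, hYX, hYq⟩
      rw [Finset.mem_map] at hX
      obtain ⟨s, hs, rfl⟩ := hX
      obtain ⟨t, rfl⟩ := up_surj Y (fun x hx => ((up_mem _ _).1 (hYX hx)).1)
      refine ⟨t, ?_, rfl⟩
      rw [Finset.mem_shadow_iterate_iff_exists_mem_card_add]
      refine ⟨s, hs, (up_sub _ _).1 hYX, ?_⟩
      rw [up_card] at hYq
      have := hD hs
      omega
    · rintro ⟨t, ht, rfl⟩
      rw [Finset.mem_shadow_iterate_iff_exists_mem_card_add] at ht
      obtain ⟨s, hs, hts, hc⟩ := ht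
      refine ⟨up s, Finset.mem_map_of_mem _ hs, (up_sub _ _).2 hts, ?_⟩
      rw [up_card]
      have := hD hs
      omega
  obtain ⟨G', hG'⟩ : ∃ G' : Finset (Finset (Fin n)), G'.map up = G := by
    refine ⟨Finset.univ.filter (fun s => up s ∈ G), ?_⟩
    ext X
    rw [Finset.mem_map]
    constructor
    · rintro ⟨s, hs, rfl⟩; simpa using hs
    · intro hX
      obtain ⟨s, rfl⟩ := up_surj X (hGn X hX)
      exact ⟨s, by simpa using hX, rfl⟩
  have hG's : (G' : Set (Finset (Fin n))).Sized r := by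
    intro s hs
    rw [← up_card]
    exact hr _ (hG' ▸ Finset.mem_map_of_mem _ hs)
  have hG'c : G'.card = G.card := by rw [← hG', Finset.card_map]
  obtain ⟨C, hC, hCc⟩ := exists_initSeg_card n r G.card
    (hN.trans (Nat.choose_le_choose _ hNn))
  have rng_card : ∀ M, M ≤ n →
      (Finset.powersetCard r (Finset.univ.filter (fun x : Fin n => x.val < M))).card
        = M.choose r := by
    intro M hM
    rw [Finset.card_powersetCard]
    congr 1
    rw [← up_card]
    have : up (Finset.univ.filter (fun x : Fin n => x.val < M)) = Finset.range M := by
      ext x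
      rw [up_mem]
      simp
      omega
    rw [this, Finset.card_range]
  have rng_up : ∀ M, M ≤ n →
      (Finset.powersetCard r (Finset.univ.filter (fun x : Fin n => x.val < M))).map up
        = Finset.powersetCard r (Finset.range M) := by
    intro M hM
    ext X
    rw [Finset.mem_map, Finset.mem_powersetCard]
    constructor
    · rintro ⟨s, hs, rfl⟩
      rw [Finset.mem_powersetCard] at hs
      refine ⟨fun x hx => ?_, by rw [up_card]; exact hs.2⟩
      obtain ⟨h, h'⟩ := (up_mem _ _).1 hx
      simpa using hs.1 h'
    · rintro ⟨h1, h2⟩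
      obtain ⟨s, rfl⟩ := up_surj X (fun x hx => by have := h1 hx; simp at this; omega)
      refine ⟨s, ?_, rfl⟩
      rw [Finset.mem_powersetCard]
      refine ⟨fun x hx => ?_, by rw [← up_card]; exact h2⟩
      have := h1 ((up_mem _ _).2 ⟨x.2, hx⟩)
      simpa using this
  refine ⟨C.map up, ?_, by rw [Finset.card_map, hCc], ?_, ?_⟩
  · rw [← rng_up N hNn, Finset.map_subset_map]
    rcases hC.total (isInitSeg_range n r N) with h | h
    · exact h
    · exact (Finset.eq_of_subset_of_card_le h (by rw [rng_card N hNn, hCc]; exact hN)).ge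
  · intro q hq
    rw [sh_up C q hq hC.1, ← hG', sh_up G' q hq hG's, Finset.card_map, Finset.card_map]
    exact Finset.iterated_kk hG's (by rw [hCc, hG'c]) hC
  · intro M hM hMc
    rw [Finset.card_map] at hMc
    rw [← rng_up M (hM.trans hNn), Finset.map_subset_map]
    rcases hC.total (isInitSeg_range n r M) with h | h
    · exact (Finset.eq_of_subset_of_card_le h (by rw [rng_card M (hM.trans hNn)]; exact hMc)).ge
    · exact h


theorem count_between (V S T : Finset ℕ) (k : ℕ) (hS : S ⊆ V) (hT : T ⊆ V) (hST : Disjoint S T)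
    (hk : S.card ≤ k) :
    ((Finset.powersetCard k V).filter (fun X => S ⊆ X ∧ Disjoint X T)).card
      = (V.card - S.card - T.card).choose (k - S.card) := by
  have h1 : ((V \ S) \ T).card = V.card - S.card - T.card := by
    rw [Finset.card_sdiff_of_subset, Finset.card_sdiff_of_subset hS]
    intro x hx
    rw [Finset.mem_sdiff]
    exact ⟨hT hx, fun h => Finset.disjoint_left.1 hST h hx⟩
  rw [← h1, ← Finset.card_powersetCard]
  symm
  refine Finset.card_bij (fun Z _ => S ∪ Z) ?_ ?_ ?_
  · intro Z hZ
    rw [Finset.mem_powersetCard] at hZ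
    have hd : Disjoint S Z := by
      rw [Finset.disjoint_left]
      intro x hx hxZ
      have := hZ.1 hxZ
      simp only [Finset.mem_sdiff] at this
      exact this.1.2 hx
    rw [Finset.mem_filter, Finset.mem_powersetCard]
    refine ⟨⟨?_, ?_⟩, Finset.subset_union_left, ?_⟩
    · refine Finset.union_subset hS (fun x hx => ?_)
      have := hZ.1 hx
      simp only [Finset.mem_sdiff] at this
      exact this.1.1
    · rw [Finset.card_union_of_disjoint hd]; omega
    · rw [Finset.disjoint_union_left]
      refine ⟨hST, ?_⟩
      rw [Finset.disjoint_left]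
      intro x hx hxT
      have := hZ.1 hx
      simp only [Finset.mem_sdiff] at this
      exact this.2 hxT
  · intro Z hZ Z' hZ' h
    rw [Finset.mem_powersetCard] at hZ hZ'
    ext x
    have := Finset.ext_iff.1 h x
    have a1 := @hZ.1 x
    have a2 := @hZ'.1 x
    simp only [Finset.mem_union, Finset.mem_sdiff] at *
    tauto
  · intro X hX
    rw [Finset.mem_filter, Finset.mem_powersetCard] at hX
    refine ⟨X \ S, ?_, ?_⟩
    · rw [Finset.mem_powersetCard, Finset.card_sdiff_of_subset hX.2.1]
      refine ⟨fun x hx => ?_, by omega⟩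
      rw [Finset.mem_sdiff] at hx
      simp only [Finset.mem_sdiff]
      exact ⟨⟨hX.1.1 hx.1, hx.2⟩, fun h => Finset.disjoint_left.1 hX.2.2 hx.1 h⟩
    · exact Finset.union_sdiff_of_subset hX.2.1

theorem count_above (V S : Finset ℕ) (k : ℕ) (hS : S ⊆ V) (hk : S.card ≤ k) :
    ((Finset.powersetCard k V).filter (fun X => S ⊆ X)).card
      = (V.card - S.card).choose (k - S.card) := by
  have := count_between V S ∅ k hS (by simp) (by simp) hk
  simpa using this

theorem lym_sum (G : Finset (Finset ℕ)) (r q : ℕ) (hG : ∀ X ∈ G, X.card = r) :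
    G.card * r.choose q = ∑ Y ∈ shq q G, (G.filter (fun X => Y ⊆ X)).card := by
  have h := Finset.sum_card_bipartiteAbove_eq_sum_card_bipartiteBelow (s := G) (t := shq q G)
    (fun X Y : Finset ℕ => Y ⊆ X)
  unfold Finset.bipartiteAbove Finset.bipartiteBelow at h
  rw [← h, Finset.sum_const_nat]
  intro X hX
  rw [← hG X hX, ← Finset.card_powersetCard]
  congr 1
  ext Y
  rw [Finset.mem_filter, mem_shq, Finset.mem_powersetCard]
  constructor
  · rintro ⟨⟨_, _, _, h⟩, h'⟩; exact ⟨h', h⟩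
  · rintro ⟨h, h'⟩; exact ⟨⟨X, hX, h, h'⟩, h⟩

theorem below_le (G : Finset (Finset ℕ)) (U : Finset ℕ) (r q : ℕ) (hqr : q ≤ r)
    (hG : G ⊆ Finset.powersetCard r U) (Y : Finset ℕ) (hY : Y ∈ shq q G) :
    (G.filter (fun X => Y ⊆ X)).card ≤ (U.card - q).choose (r - q) := by
  obtain ⟨X, hX, hYX, hYc⟩ := mem_shq.1 hY
  have := count_above U Y r (hYX.trans (Finset.mem_powersetCard.1 (hG hX)).1) (by omega)
  rw [hYc] at this
  rw [← this]
  exact Finset.card_le_card (Finset.filter_subset_filter _ hG)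

theorem lym_mul (G : Finset (Finset ℕ)) (U : Finset ℕ) (r q : ℕ) (hqr : q ≤ r)
    (hG : G ⊆ Finset.powersetCard r U) :
    G.card * r.choose q ≤ (shq q G).card * (U.card - q).choose (r - q) := by
  rw [lym_sum G r q (fun X hX => (Finset.mem_powersetCard.1 (hG hX)).2), ← smul_eq_mul]
  exact Finset.sum_le_card_nsmul _ _ _ (fun Y hY => below_le G U r q hqr hG Y hY)

theorem swap_closed (G : Finset (Finset ℕ)) (U : Finset ℕ) (r : ℕ)
    (hG : G ⊆ Finset.powersetCard r U) (hne : G.Nonempty)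
    (hsw : ∀ X ∈ G, ∀ a ∈ X, ∀ b ∈ U, b ∉ X → insert b (X.erase a) ∈ G) :
    G = Finset.powersetCard r U := by
  refine Finset.Subset.antisymm hG ?_
  intro Z hZ
  rw [Finset.mem_powersetCard] at hZ
  obtain ⟨X, hX, hmin⟩ := Finset.exists_min_image G (fun X => (X \ Z).card) hne
  have hXr := Finset.mem_powersetCard.1 (hG hX)
  by_cases h0 : X \ Z = ∅
  · have : X = Z := Finset.eq_of_subset_of_card_le (Finset.sdiff_eq_empty_iff_subset.1 h0)
      (by omega)
    exact this ▸ hX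
  · exfalso
    have hc : (X \ Z).card = (Z \ X).card := by
      apply Finset.card_sdiff_comm; omega
    obtain ⟨a, ha⟩ := Finset.nonempty_iff_ne_empty.2 h0
    have : 0 < (Z \ X).card := by rw [← hc]; exact Finset.card_pos.2 ⟨a, ha⟩
    obtain ⟨b, hb⟩ := Finset.card_pos.1 this
    rw [Finset.mem_sdiff] at ha hb
    have h1 := hmin _ (hsw X hX a ha.1 b (hZ.1 hb.1) hb.2)
    have h2 : (insert b (X.erase a) \ Z) ⊂ X \ Z := by
      rw [Finset.ssubset_iff]
      refine ⟨a, ?_, ?_⟩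
      · simp only [Finset.mem_sdiff, Finset.mem_insert, Finset.mem_erase]
        rintro ⟨h | h, _⟩
        · exact hb.2 (h ▸ ha.1)
        · exact h.1 rfl
      · intro x hx
        simp only [Finset.mem_sdiff, Finset.mem_insert, Finset.mem_erase] at *
        rcases hx with rfl | ⟨rfl | h, h'⟩
        · exact ha
        · exact absurd hb.1 h'
        · exact ⟨h.2, h'⟩
    exact absurd (Finset.card_lt_card h2) (not_lt.2 h1)

theorem lym_mul_lt (G : Finset (Finset ℕ)) (U : Finset ℕ) (r q : ℕ) (hqr : q < r)
    (hG : G ⊆ Finset.powersetCard r U) (hne : G.Nonempty) (hlt : G.card < U.card.choose r) :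
    G.card * r.choose q < (shq q G).card * (U.card - q).choose (r - q) := by
  rw [lym_sum G r q (fun X hX => (Finset.mem_powersetCard.1 (hG hX)).2), ← smul_eq_mul,
    ← Finset.sum_const]
  by_contra hcon
  have hle := fun Y hY => below_le G U r q hqr.le hG Y hY
  have heq : ∀ Y ∈ shq q G, (G.filter (fun X => Y ⊆ X)).card = (U.card - q).choose (r - q) := by
    by_contra hcon2
    push Not at hcon2
    obtain ⟨Y, hY, hne⟩ := hcon2
    exact hcon (Finset.sum_lt_sum hle ⟨Y, hY, lt_of_le_of_ne (hle Y hY) hne⟩)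
  have : G = Finset.powersetCard r U := by
    apply swap_closed G U r hG hne
    intro X hX a ha b hb hbX
    have hXr := Finset.mem_powersetCard.1 (hG hX)
    obtain ⟨Y, hYX, hYc⟩ := Finset.exists_subset_card_eq (s := X.erase a) (n := q)
      (by rw [Finset.card_erase_of_mem ha]; omega)
    have hYX' : Y ⊆ X := hYX.trans (Finset.erase_subset _ _)
    have h1 := heq Y (mem_shq.2 ⟨X, hX, hYX', hYc⟩)
    have h2 := count_above U Y r (hYX'.trans hXr.1) (by omega)
    rw [hYc, ← h1] at h2
    have h3 := Finset.eq_of_subset_of_card_le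
      (Finset.filter_subset_filter (fun X => Y ⊆ X) hG) h2.le
    have h4 : insert b (X.erase a) ∈ (Finset.powersetCard r U).filter (fun X => Y ⊆ X) := by
      rw [Finset.mem_filter, Finset.mem_powersetCard]
      refine ⟨⟨?_, ?_⟩, hYX.trans (Finset.subset_insert _ _)⟩
      · rw [Finset.insert_subset_iff]
        exact ⟨hb, (Finset.erase_subset _ _).trans hXr.1⟩
      · rw [Finset.card_insert_of_notMem (fun h => hbX (Finset.mem_of_mem_erase h)),
          Finset.card_erase_of_mem ha]
        omega
    rw [← h3] at h4
    exact (Finset.mem_filter.1 h4).1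
  rw [this, Finset.card_powersetCard] at hlt
  exact lt_irrefl _ hlt

theorem choose_pos_of_card {G : Finset (Finset ℕ)} {N r : ℕ} (h : G.card ≤ N.choose r)
    (hne : G.Nonempty) : r ≤ N := by
  by_contra hlt
  rw [Nat.choose_eq_zero_of_lt (by omega)] at h
  have := Finset.card_pos.2 hne
  omega

theorem LK (G : Finset (Finset ℕ)) (r q N : ℕ) (hqr : q ≤ r) (hr : ∀ X ∈ G, X.card = r)
    (hN : G.card ≤ N.choose r) : G.card * N.choose q ≤ (shq q G).card * N.choose r := by
  rcases G.eq_empty_or_nonempty with rfl | hne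
  · simp
  have hrN := choose_pos_of_card hN hne
  obtain ⟨C, hC, hCc, hCs, _⟩ := kk_init G r N hr hN
  have h1 := lym_mul C (Finset.range N) r q hqr hC
  rw [Finset.card_range, hCc] at h1
  have h2 := Nat.choose_mul (n := N) hqr
  have h3 : 0 < r.choose q := Nat.choose_pos hqr
  refine le_trans ?_ (Nat.mul_le_mul_right _ (hCs q hqr))
  have h4 := Nat.mul_le_mul_right (N.choose q) h1
  refine Nat.le_of_mul_le_mul_right ?_ h3
  calc G.card * N.choose q * r.choose q = G.card * r.choose q * N.choose q := by ring
    _ ≤ _ := h4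
    _ = (shq q C).card * (N.choose q * (N - q).choose (r - q)) := by ring
    _ = _ := by rw [← h2]; ring

theorem LKs (G : Finset (Finset ℕ)) (r q N : ℕ) (hqr : q < r) (hr : ∀ X ∈ G, X.card = r)
    (hne : G.Nonempty) (hN : G.card < N.choose r) :
    G.card * N.choose q < (shq q G).card * N.choose r := by
  have hrN := choose_pos_of_card hN.le hne
  obtain ⟨C, hC, hCc, hCs, _⟩ := kk_init G r N hr hN.le
  have hCne : C.Nonempty := by rw [← Finset.card_pos, hCc]; exact Finset.card_pos.2 hne
  have h1 := lym_mul_lt C (Finset.range N) r q hqr hC hCne (by rw [Finset.card_range, hCc]; exact hN)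
  rw [Finset.card_range, hCc] at h1
  have h2 := Nat.choose_mul (n := N) hqr.le
  have h3 : 0 < r.choose q := Nat.choose_pos hqr.le
  have h5 : 0 < N.choose q := Nat.choose_pos (by omega)
  refine lt_of_lt_of_le ?_ (Nat.mul_le_mul_right _ (hCs q hqr.le))
  have h4 := Nat.mul_lt_mul_of_pos_right h1 h5
  refine Nat.lt_of_mul_lt_mul_right (a := r.choose q) ?_
  calc G.card * N.choose q * r.choose q = G.card * r.choose q * N.choose q := by ring
    _ < _ := h4
    _ = (shq q C).card * (N.choose q * (N - q).choose (r - q)) := by ring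
    _ = _ := by rw [← h2]; ring

/-- balanced version -/
theorem LK_bal (G : Finset (Finset ℕ)) (r q : ℕ) (hqr : q ≤ r) (hr : ∀ X ∈ G, X.card = r)
    (hN : G.card ≤ (q + r).choose r) : G.card ≤ (shq q G).card := by
  have h := LK G r q (q + r) hqr hr hN
  rw [show (q + r).choose q = (q + r).choose r from by
    rw [← Nat.choose_symm_add]] at h
  exact Nat.le_of_mul_le_mul_right h (Nat.choose_pos (by omega))

theorem LKs_bal (G : Finset (Finset ℕ)) (r q : ℕ) (hqr : q < r) (hr : ∀ X ∈ G, X.card = r)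
    (hne : G.Nonempty) (hN : G.card < (q + r).choose r) : G.card < (shq q G).card := by
  have h := LKs G r q (q + r) hqr hr hne hN
  rw [show (q + r).choose q = (q + r).choose r from by
    rw [← Nat.choose_symm_add]] at h
  exact Nat.lt_of_mul_lt_mul_right h

theorem LKL (G : Finset (Finset ℕ)) (r q N : ℕ) (hqr : q ≤ r) (hrN : r ≤ N)
    (hr : ∀ X ∈ G, X.card = r) (hN : N.choose r ≤ G.card) : N.choose q ≤ (shq q G).card := by
  obtain ⟨H, hH, hHc⟩ := Finset.exists_subset_card_eq hN
  have h := LK H r q N hqr (fun X hX => hr X (hH hX)) hHc.le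
  rw [hHc, mul_comm] at h
  exact (Nat.le_of_mul_le_mul_right h (Nat.choose_pos hrN)).trans
    (Finset.card_le_card (shq_mono hH))

theorem LK2 (G : Finset (Finset ℕ)) (r q N : ℕ) (hq : 1 ≤ q) (hqr : q ≤ r) (hNe : N + 2 = q + r)
    (hrN : r ≤ N)
    (hr : ∀ X ∈ G, X.card = r) (h1 : N.choose r ≤ G.card) (h2 : G.card ≤ (N + 1).choose r) :
    G.card + N.choose q ≤ (shq q G).card + N.choose r := by
  obtain ⟨C, hC, hCc, hCs, hCM⟩ := kk_init G r (N + 1) hr h2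
  have hM := hCM N (by omega) (by omega)
  refine le_trans ?_ (Nat.add_le_add_right (hCs q hqr) _)
  rw [← hCc]
  set C0 := C.filter (fun X => N ∉ X) with hC0
  set C1 := C.filter (fun X => N ∈ X) with hC1
  have hsplit : C1.card + C0.card = C.card := Finset.card_filter_add_card_filter_not (s := C) _
  have hC0le : C0.card ≤ N.choose r := by
    rw [← Finset.card_range N, ← Finset.card_powersetCard]
    apply Finset.card_le_card
    intro X hX
    rw [hC0, Finset.mem_filter] at hX
    have := Finset.mem_powersetCard.1 (hC hX.1)
    rw [Finset.mem_powersetCard]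
    refine ⟨fun x hx => ?_, this.2⟩
    have h3 := this.1 hx
    rw [Finset.mem_range] at h3 ⊢
    have : x ≠ N := fun h => hX.2 (h ▸ hx)
    omega
  set C' := C1.image (fun X => X.erase N) with hC'
  have hC'c : C'.card = C1.card := by
    apply Finset.card_image_of_injOn
    intro X hX Y hY hXY
    rw [hC1, Finset.mem_coe, Finset.mem_filter] at hX hY
    have := congrArg (insert N) hXY
    simpa [Finset.insert_erase hX.2, Finset.insert_erase hY.2] using this
  have hC's : C' ⊆ Finset.powersetCard (r - 1) (Finset.range N) := by
    intro X hX
    rw [hC', Finset.mem_image] at hX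
    obtain ⟨Z, hZ, rfl⟩ := hX
    rw [hC1, Finset.mem_filter] at hZ
    have := Finset.mem_powersetCard.1 (hC hZ.1)
    rw [Finset.mem_powersetCard, Finset.card_erase_of_mem hZ.2]
    refine ⟨fun x hx => ?_, by omega⟩
    rw [Finset.mem_erase] at hx
    have h3 := this.1 hx.2
    rw [Finset.mem_range] at h3 ⊢
    omega
  have hC'sh : C'.card ≤ (shq (q - 1) C').card := by
    apply LK_bal C' (r - 1) (q - 1) (by omega)
      (fun X hX => (Finset.mem_powersetCard.1 (hC's hX)).2)
    have := Finset.card_le_card hC's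
    rw [Finset.card_powersetCard, Finset.card_range] at this
    rw [show q - 1 + (r - 1) = N by omega]
    exact this
  have hsub : Finset.powersetCard q (Finset.range N) ∪ (shq (q - 1) C').image (insert N)
      ⊆ shq q C := by
    apply Finset.union_subset
    · intro Y hY
      rw [Finset.mem_powersetCard] at hY
      obtain ⟨X, hYX, hXN, hXc⟩ := Finset.exists_subsuperset_card_eq (n := r) hY.1 (by omega)
        (by rw [Finset.card_range]; omega)
      exact mem_shq.2 ⟨X, hM (Finset.mem_powersetCard.2 ⟨hXN, hXc⟩), hYX, hY.2⟩
    · intro Y hY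
      rw [Finset.mem_image] at hY
      obtain ⟨Y, hY, rfl⟩ := hY
      obtain ⟨X, hX, hYX, hYc⟩ := mem_shq.1 hY
      have hXN := Finset.mem_powersetCard.1 (hC's hX)
      rw [hC', Finset.mem_image] at hX
      obtain ⟨Z, hZ, rfl⟩ := hX
      rw [hC1, Finset.mem_filter] at hZ
      refine mem_shq.2 ⟨Z, hZ.1, ?_, ?_⟩
      · rw [Finset.insert_subset_iff]
        exact ⟨hZ.2, hYX.trans (Finset.erase_subset _ _)⟩
      · rw [Finset.card_insert_of_notMem]
        · omega
        · intro h; exact Finset.notMem_erase _ _ (hYX h)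
  have hdisj : Disjoint (Finset.powersetCard q (Finset.range N))
      ((shq (q - 1) C').image (insert N)) := by
    rw [Finset.disjoint_left]
    intro Y hY hY'
    rw [Finset.mem_image] at hY'
    obtain ⟨Z, _, rfl⟩ := hY'
    have := (Finset.mem_powersetCard.1 hY).1 (Finset.mem_insert_self _ _)
    simp at this
  have hinj : ((shq (q - 1) C').image (insert N)).card = (shq (q - 1) C').card := by
    apply Finset.card_image_of_injOn
    intro X hX Y hY hXY
    have aux : ∀ X ∈ shq (q - 1) C', N ∉ X := by
      intro X hX hN
      obtain ⟨Z, hZ, hXZ, _⟩ := mem_shq.1 hX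
      have := (Finset.mem_powersetCard.1 (hC's hZ)).1 (hXZ hN)
      simp at this
    have := congrArg (fun s => Finset.erase s N) hXY
    simpa [Finset.erase_insert (aux X hX), Finset.erase_insert (aux Y hY)] using this
  have hfin := Finset.card_le_card hsub
  rw [Finset.card_union_of_disjoint hdisj, hinj, Finset.card_powersetCard, Finset.card_range]
    at hfin
  omega

/-- complements inside `V` -/
def coV (V : Finset ℕ) (B : Finset (Finset ℕ)) : Finset (Finset ℕ) := B.image (fun X => V \ X)

theorem coV_card (V : Finset ℕ) (B : Finset (Finset ℕ)) (hB : ∀ X ∈ B, X ⊆ V) :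
    (coV V B).card = B.card := by
  apply Finset.card_image_of_injOn
  intro X hX Y hY h
  have := congrArg (fun Z => V \ Z) h
  simpa [Finset.sdiff_sdiff_eq_self (hB X hX), Finset.sdiff_sdiff_eq_self (hB Y hY)] using this

theorem mem_shq_coV {V : Finset ℕ} {B : Finset (Finset ℕ)} {q : ℕ} {Y : Finset ℕ} :
    Y ∈ shq q (coV V B) ↔ ∃ X ∈ B, Y ⊆ V ∧ Disjoint Y X ∧ Y.card = q := by
  rw [mem_shq]
  unfold coV
  constructor
  · rintro ⟨Z, hZ, h1, h2⟩
    rw [Finset.mem_image] at hZ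
    obtain ⟨X, hX, rfl⟩ := hZ
    rw [Finset.subset_sdiff] at h1
    exact ⟨X, hX, h1.1, h1.2, h2⟩
  · rintro ⟨X, hX, h1, h2, h3⟩
    exact ⟨V \ X, Finset.mem_image_of_mem _ hX, Finset.subset_sdiff.2 ⟨h1, h2⟩, h3⟩

theorem coV_sized {V : Finset ℕ} {B : Finset (Finset ℕ)} {p : ℕ}
    (hB : B ⊆ Finset.powersetCard p V) : ∀ X ∈ coV V B, X.card = V.card - p := by
  intro X hX
  unfold coV at hX
  rw [Finset.mem_image] at hX
  obtain ⟨Z, hZ, rfl⟩ := hX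
  have := Finset.mem_powersetCard.1 (hB hZ)
  rw [Finset.card_sdiff_of_subset this.1, this.2]

theorem cross_bound (V : Finset ℕ) (A B : Finset (Finset ℕ)) (q : ℕ)
    (hA : A ⊆ Finset.powersetCard q V)
    (hc : ∀ Y ∈ A, ∀ X ∈ B, (Y ∩ X).Nonempty) :
    A.card + (shq q (coV V B)).card ≤ V.card.choose q := by
  rw [← Finset.card_powersetCard, ← Finset.card_union_of_disjoint]
  · apply Finset.card_le_card
    apply Finset.union_subset hA
    intro Y hY
    obtain ⟨X, hX, h1, h2, h3⟩ := mem_shq_coV.1 hY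
    exact Finset.mem_powersetCard.2 ⟨h1, h3⟩
  · rw [Finset.disjoint_left]
    intro Y hY hY'
    obtain ⟨X, hX, h1, h2, h3⟩ := mem_shq_coV.1 hY'
    have := hc Y hY X hX
    rw [Finset.disjoint_iff_inter_eq_empty] at h2
    simp [h2] at this


theorem struct_lem (B : Finset (Finset ℕ)) (r : ℕ) (hr : 1 ≤ r) (hB : ∀ X ∈ B, X.card = r)
    (hne : B.Nonempty)
    (hp : ∀ X ∈ B, ∀ Y ∈ B, X ≠ Y → (X ∩ Y).card = r - 1) :
    (∃ K : Finset ℕ, K.card = r - 1 ∧ ∀ X ∈ B, K ⊆ X) ∨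
    (3 ≤ B.card ∧ ∃ B1 ∈ B, ∃ B2 ∈ B, (B1 ∪ B2).card = r + 1 ∧ ∀ X ∈ B, X ⊆ B1 ∪ B2) := by
  by_cases h1 : ∃ B1 ∈ B, ∃ B2 ∈ B, B1 ≠ B2
  · obtain ⟨B1, hB1, B2, hB2, h12⟩ := h1
    have hK := hp B1 hB1 B2 hB2 h12
    by_cases h2 : ∀ X ∈ B, B1 ∩ B2 ⊆ X
    · exact Or.inl ⟨B1 ∩ B2, hK, h2⟩
    · right
      push Not at h2
      obtain ⟨X0, hX0, hnot⟩ := h2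
      have hx1 : X0 ≠ B1 := by rintro rfl; exact hnot Finset.inter_subset_left
      have hx2 : X0 ≠ B2 := by rintro rfl; exact hnot Finset.inter_subset_right
      have hW : (B1 ∪ B2).card = r + 1 := by
        have := Finset.card_union_add_card_inter B1 B2
        rw [hB B1 hB1, hB B2 hB2, hK] at this; omega
      have key : ∀ X ∈ B, ¬ (B1 ∩ B2 ⊆ X) → X ⊆ B1 ∪ B2 := by
        intro X hX hn
        have hx1 : X ≠ B1 := by rintro rfl; exact hn Finset.inter_subset_left
        have hx2 : X ≠ B2 := by rintro rfl; exact hn Finset.inter_subset_right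
        have e1 := hp X hX B1 hB1 hx1
        have e2 := hp X hX B2 hB2 hx2
        have e3 := Finset.card_union_add_card_inter (X ∩ B1) (X ∩ B2)
        rw [← Finset.inter_union_distrib_left, ← Finset.inter_inter_distrib_left, e1, e2] at e3
        have e4 : (X ∩ (B1 ∩ B2)).card < (B1 ∩ B2).card := by
          apply Finset.card_lt_card
          refine ⟨Finset.inter_subset_right, fun h => hn ?_⟩
          exact h.trans Finset.inter_subset_left
        have e5 : X ∩ (B1 ∪ B2) = X := by
          apply Finset.eq_of_subset_of_card_le Finset.inter_subset_left
          rw [hB X hX]; omega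
        exact Finset.inter_eq_left.1 e5
      refine ⟨?_, B1, hB1, B2, hB2, hW, ?_⟩
      · have : ({X0, B1, B2} : Finset (Finset ℕ)) ⊆ B := by
          intro x hx; simp only [Finset.mem_insert, Finset.mem_singleton] at hx
          rcases hx with rfl | rfl | rfl <;> assumption
        have h3 := Finset.card_le_card this
        rw [Finset.card_eq_three.2 ⟨X0, B1, B2, hx1, hx2, h12, rfl⟩] at h3
        exact h3
      · intro Z hZ
        by_cases hz : B1 ∩ B2 ⊆ Z
        · by_contra hcon
          have hZX : Z ≠ X0 := by rintro rfl; exact hnot hz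
          have e0 := hp Z hZ X0 hX0 hZX
          have e1 : (Z ∩ (B1 ∪ B2)).card < Z.card := by
            apply Finset.card_lt_card
            refine ⟨Finset.inter_subset_left, fun h => hcon ?_⟩
            exact h.trans Finset.inter_subset_right
          have e2 : B1 ∩ B2 ⊆ Z ∩ (B1 ∪ B2) :=
            Finset.subset_inter hz (Finset.inter_subset_left.trans Finset.subset_union_left)
          have e3 := Finset.eq_of_subset_of_card_le e2 (by rw [hB Z hZ] at e1; omega)
          have e4 : Z ∩ X0 ⊆ B1 ∩ B2 := by
            rw [e3]
            exact Finset.inter_subset_inter_left (key X0 hX0 hnot)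
          have e5 := Finset.eq_of_subset_of_card_le e4 (by omega)
          exact hnot (e5 ▸ Finset.inter_subset_right)
        · exact key Z hZ hz
  · left
    push Not at h1
    obtain ⟨X, hX⟩ := hne
    obtain ⟨K, hKX, hK⟩ := Finset.exists_subset_card_eq (s := X) (n := r - 1)
      (by rw [hB X hX]; omega)
    exact ⟨K, hK, fun Y hY => h1 X hX Y hY ▸ hKX⟩

theorem star_card (C : Finset (Finset ℕ)) (U K : Finset ℕ) (r : ℕ) (hr : 1 ≤ r)
    (hC : ∀ X ∈ C, X ⊆ U ∧ X.card = r) (hKc : K.card = r - 1) (hK : ∀ X ∈ C, K ⊆ X) :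
    C.card ≤ (U \ K).card := by
  have : C ⊆ (U \ K).image (fun x => insert x K) := by
    intro X hX
    have h1 : (X \ K).card = 1 := by
      rw [Finset.card_sdiff_of_subset (hK X hX), (hC X hX).2]; omega
    obtain ⟨x, hx⟩ := Finset.card_eq_one.1 h1
    rw [Finset.mem_image]
    refine ⟨x, ?_, ?_⟩
    · have : x ∈ X \ K := by rw [hx]; simp
      rw [Finset.mem_sdiff] at this ⊢
      exact ⟨(hC X hX).1 this.1, this.2⟩
    · rw [← Finset.union_sdiff_of_subset (hK X hX), hx, Finset.union_comm]; rfl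
  exact (Finset.card_le_card this).trans Finset.card_image_le

theorem count_lem (r : ℕ) (hr : 3 ≤ r) : ∀ (u : ℕ) (U : Finset ℕ) (G : Finset (Finset ℕ)),
    U.card = u → G ⊆ Finset.powersetCard r U →
    (∀ X ∈ G, ∀ Y ∈ G, X ≠ Y → (X ∩ Y).card = 0 ∨ (X ∩ Y).card = r - 1) → G.card ≤ U.card := by
  intro u
  induction u using Nat.strong_induction_on with
  | _ u ih =>
    intro U G hU hG hp
    rcases G.eq_empty_or_nonempty with rfl | ⟨X0, hX0⟩
    · simp
    have hGc : ∀ X ∈ G, X ⊆ U ∧ X.card = r := fun X hX => Finset.mem_powersetCard.1 (hG hX)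
    set C := G.filter (fun X => (X ∩ X0).card ≠ 0) with hC
    have hCG : C ⊆ G := Finset.filter_subset _ _
    have hX0C : X0 ∈ C := by
      rw [hC, Finset.mem_filter, Finset.inter_self, (hGc X0 hX0).2]; exact ⟨hX0, by omega⟩
    have hC1 : ∀ X ∈ C, r - 1 ≤ (X ∩ X0).card := by
      intro X hX
      by_cases h : X = X0
      · rw [h, Finset.inter_self, (hGc X0 hX0).2]; omega
      · rw [hC, Finset.mem_filter] at hX
        rcases hp X hX.1 X0 hX0 h with h' | h'
        · exact absurd h' hX.2
        · omega
    have hCp : ∀ X ∈ C, ∀ Y ∈ C, X ≠ Y → (X ∩ Y).card = r - 1 := by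
      intro X hX Y hY hne
      rcases hp X (hCG hX) Y (hCG hY) hne with h | h
      · exfalso
        have e := Finset.card_union_add_card_inter (X ∩ X0) (Y ∩ X0)
        have e1 : ((X ∩ X0) ∪ (Y ∩ X0)).card ≤ r := by
          rw [← (hGc X0 hX0).2]
          exact Finset.card_le_card (Finset.union_subset Finset.inter_subset_right
            Finset.inter_subset_right)
        have e2 : ((X ∩ X0) ∩ (Y ∩ X0)).card ≤ (X ∩ Y).card := Finset.card_le_card
          (Finset.inter_subset_inter Finset.inter_subset_left Finset.inter_subset_left)
        have := hC1 X hX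
        have := hC1 Y hY
        omega
      · exact h
    set U' := C.biUnion id with hU'
    have hU'U : U' ⊆ U := by
      rw [hU', Finset.biUnion_subset]
      intro X hX; exact (hGc X (hCG hX)).1
    have hCU' : ∀ X ∈ C, X ⊆ U' := fun X hX => Finset.subset_biUnion_of_mem id hX
    have hCcard : C.card ≤ U'.card := by
      rcases struct_lem C r (by omega) (fun X hX => (hGc X (hCG hX)).2) ⟨X0, hX0C⟩ hCp with h | h
      · obtain ⟨K, hKc, hK⟩ := h
        exact (star_card C U' K r (by omega) (fun X hX => ⟨hCU' X hX, (hGc X (hCG hX)).2⟩)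
          hKc hK).trans (Finset.card_le_card Finset.sdiff_subset)
      · obtain ⟨_, B1, hB1, B2, hB2, hW, hall⟩ := h
        have : C ⊆ Finset.powersetCard r (B1 ∪ B2) := fun X hX =>
          Finset.mem_powersetCard.2 ⟨hall X hX, (hGc X (hCG hX)).2⟩
        have h2 := Finset.card_le_card this
        rw [Finset.card_powersetCard, hW, Nat.choose_succ_self_right, ← hW] at h2
        exact h2.trans (Finset.card_le_card (Finset.union_subset (hCU' B1 hB1) (hCU' B2 hB2)))
    have hrest : (G.filter (fun X => ¬ (X ∩ X0).card ≠ 0)).card ≤ (U \ U').card := by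
      have hlt : (U \ U').card < u := by
        rw [← hU]
        apply Finset.card_lt_card
        refine ⟨Finset.sdiff_subset, fun h => ?_⟩
        have : X0.Nonempty := by rw [← Finset.card_pos, (hGc X0 hX0).2]; omega
        obtain ⟨x, hx⟩ := this
        have := h ((hGc X0 hX0).1 hx)
        rw [Finset.mem_sdiff] at this
        exact this.2 (hCU' X0 hX0C hx)
      apply ih _ hlt (U \ U') _ rfl
      · intro Z hZ
        rw [Finset.mem_filter] at hZ
        push Not at hZ
        rw [Finset.mem_powersetCard, Finset.subset_sdiff]
        refine ⟨⟨(hGc Z hZ.1).1, ?_⟩, (hGc Z hZ.1).2⟩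
        rw [hU', Finset.disjoint_biUnion_right]
        intro X hX
        rw [id, Finset.disjoint_iff_inter_eq_empty, ← Finset.card_eq_zero]
        by_contra hcon
        have hZX : Z ≠ X := by
          rintro rfl
          rw [hC, Finset.mem_filter] at hX
          exact hX.2 hZ.2
        have h1 : (Z ∩ X).card = r - 1 := by
          rcases hp Z hZ.1 X (hCG hX) hZX with h | h
          · exact absurd h hcon
          · exact h
        have h2 : Z ∩ X ⊆ X \ X0 := by
          intro z hz
          rw [Finset.mem_inter] at hz
          rw [Finset.mem_sdiff]
          refine ⟨hz.2, fun h => ?_⟩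
          have : z ∈ Z ∩ X0 := Finset.mem_inter.2 ⟨hz.1, h⟩
          rw [Finset.card_eq_zero] at hZ
          rw [hZ.2] at this
          exact absurd this (Finset.notMem_empty _)
        have h3 := Finset.card_le_card h2
        have h4 := Finset.card_sdiff_add_card_inter X X0
        have h5 := hC1 X hX
        rw [(hGc X (hCG hX)).2] at h4
        omega
      · intro X hX Y hY
        exact hp X (Finset.filter_subset _ _ hX) Y (Finset.filter_subset _ _ hY)
    have hs : C.card + (G.filter (fun X => ¬ (X ∩ X0).card ≠ 0)).card = G.card :=
      Finset.card_filter_add_card_filter_not (s := G) _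
    rw [Finset.card_sdiff_of_subset hU'U] at hrest
    have := Finset.card_le_card hU'U
    omega

/-- the sets `Y` of size `k-1` containing `T` and missing some member of `G` -/
def EE (V T : Finset ℕ) (k : ℕ) (G : Finset (Finset ℕ)) : Finset (Finset ℕ) :=
  (Finset.powersetCard (k - 1) V).filter (fun Y => T ⊆ Y ∧ ∃ X ∈ G, Disjoint Y X)

theorem EE_lt (V T : Finset ℕ) (k : ℕ) (G : Finset (Finset ℕ)) (hv : 2 * k ≤ V.card)
    (hT : T ⊆ V) (hTk : T.card + 1 ≤ k) (hG : G ⊆ Finset.powersetCard k V)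
    (hd : ∀ X ∈ G, Disjoint T X) (hne : G.Nonempty)
    (hlt : G.card < (V.card - 2 * T.card - 1).choose (V.card - T.card - k)) :
    G.card < (EE V T k G).card := by
  have hG' : G ⊆ Finset.powersetCard k (V \ T) := by
    intro X hX
    have := Finset.mem_powersetCard.1 (hG hX)
    rw [Finset.mem_powersetCard, Finset.subset_sdiff]
    exact ⟨⟨this.1, (hd X hX).symm⟩, this.2⟩
  have hVT := Finset.card_sdiff_of_subset hT
  have h1 := coV_sized hG'
  have h2 := coV_card (V \ T) G (fun X hX => (Finset.mem_powersetCard.1 (hG' hX)).1)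
  have hTV := Finset.card_le_card hT
  have h3 := LKs_bal (coV (V \ T) G) (V.card - T.card - k) (k - 1 - T.card) (by omega)
    (by rw [hVT] at h1; exact h1)
    (by rw [← Finset.card_pos, h2]; exact Finset.card_pos.2 hne)
    (by rw [h2, show k - 1 - T.card + (V.card - T.card - k) = V.card - 2 * T.card - 1 by omega]
        exact hlt)
  rw [h2] at h3
  refine lt_of_lt_of_le h3 ?_
  apply Finset.card_le_card_of_injOn (fun Y => T ∪ Y)
  · intro Y hY
    obtain ⟨X, hX, hYV, hYX, hYc⟩ := mem_shq_coV.1 hY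
    rw [Finset.subset_sdiff] at hYV
    simp only [EE, Finset.coe_filter, Finset.mem_powersetCard, Set.mem_ofPred_eq]
    refine ⟨⟨Finset.union_subset hT hYV.1, ?_⟩, Finset.subset_union_left, X, hX, ?_⟩
    · rw [Finset.card_union_of_disjoint hYV.2.symm]; omega
    · exact Finset.disjoint_union_left.2 ⟨hd X hX, hYX⟩
  · intro Y hY Y' hY' h
    obtain ⟨X, hX, hYV, hYX, hYc⟩ := mem_shq_coV.1 hY
    obtain ⟨X', hX', hYV', hYX', hYc'⟩ := mem_shq_coV.1 hY'
    rw [Finset.subset_sdiff] at hYV hYV'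
    have h5 := congrArg (fun Z => Z \ T) h
    simpa [Finset.union_sdiff_distrib, Finset.sdiff_eq_self_of_disjoint hYV.2,
      Finset.sdiff_eq_self_of_disjoint hYV'.2] using h5

theorem label_sum (R : Finset (Finset ℕ)) (lab : Finset ℕ → Finset ℕ)
    (E : Finset ℕ → Finset (Finset ℕ)) (D : Finset (Finset ℕ)) (labY : Finset ℕ → Finset ℕ)
    (hne : R.Nonempty)
    (h1 : ∀ T ∈ R.image lab, (R.filter (fun X => lab X = T)).card < (E T).card)
    (h2 : ∀ T ∈ R.image lab, E T ⊆ D) (h3 : ∀ T ∈ R.image lab, ∀ Y ∈ E T, labY Y = T) :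
    R.card < D.card := by
  rw [Finset.card_eq_sum_card_image lab R]
  have : ((R.image lab).biUnion E).card ≤ D.card :=
    Finset.card_le_card (Finset.biUnion_subset.2 h2)
  refine lt_of_lt_of_le ?_ this
  rw [Finset.card_biUnion]
  · exact Finset.sum_lt_sum_of_nonempty (hne.image _) h1
  · intro T hT T' hT' hTT'
    change Disjoint (E T) (E T')
    rw [Finset.disjoint_left]
    intro Y hY hY'
    exact hTT' ((h3 T hT Y hY).symm.trans (h3 T' hT' Y hY'))


theorem Wcase_D (V W : Finset ℕ) (k : ℕ) (B : Finset (Finset ℕ)) (hk : 2 ≤ k)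
    (hB : B ⊆ Finset.powersetCard k V) (hW : W ⊆ V) (hWc : W.card = k + 1)
    (hBW : ∀ X ∈ B, X ⊆ W) :
    (V.card - (k + 1)).choose (k - 1) + B.card * (V.card - (k + 1)).choose (k - 2)
      ≤ (shq (k - 1) (coV V B)).card ∨ B = ∅ := by
  rcases B.eq_empty_or_nonempty with h | ⟨X0, hX0⟩
  · exact Or.inr h
  left
  set E0 := (Finset.powersetCard (k - 1) V).filter (fun Y => ∅ ⊆ Y ∧ Disjoint Y W) with hE0
  set E := fun X : Finset ℕ =>
    (Finset.powersetCard (k - 1) V).filter (fun Y => W \ X ⊆ Y ∧ Disjoint Y X) with hE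
  have hBc : ∀ X ∈ B, X ⊆ V ∧ X.card = k := fun X hX => Finset.mem_powersetCard.1 (hB hX)
  have hE0c : E0.card = (V.card - (k + 1)).choose (k - 1) := by
    have := count_between V ∅ W (k - 1) (by simp) hW (by simp) (by simp)
    rw [hE0, this, hWc]; simp
  have hWX : ∀ X ∈ B, (W \ X).card = 1 := by
    intro X hX
    rw [Finset.card_sdiff_of_subset (hBW X hX), hWc, (hBc X hX).2]; omega
  have hEc : ∀ X ∈ B, (E X).card = (V.card - (k + 1)).choose (k - 2) := by
    intro X hX
    have := count_between V (W \ X) X (k - 1) (Finset.sdiff_subset.trans hW) (hBc X hX).1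
      Finset.sdiff_disjoint (by rw [hWX X hX]; omega)
    rw [hE]
    simp only
    rw [this, hWX X hX, (hBc X hX).2]
    congr 1 <;> omega
  have hdis : (B : Set (Finset ℕ)).PairwiseDisjoint E := by
    intro X hX X' hX' hne
    change Disjoint (E X) (E X')
    rw [Finset.disjoint_left]
    intro Y hY hY'
    simp only [hE, Finset.mem_filter] at hY hY'
    apply hne
    have a1 : X ⊆ X' := by
      intro x hx
      by_contra hcon
      have : x ∈ Y := hY'.2.1 (Finset.mem_sdiff.2 ⟨hBW X hX hx, hcon⟩)
      exact Finset.disjoint_left.1 hY.2.2 this hx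
    exact Finset.eq_of_subset_of_card_le a1 (by rw [(hBc X hX).2, (hBc X' hX').2])
  have hbU : (B.biUnion E).card = B.card * (V.card - (k + 1)).choose (k - 2) := by
    rw [Finset.card_biUnion hdis, Finset.sum_const_nat hEc]
  rw [← hE0c, ← hbU, ← Finset.card_union_of_disjoint]
  · apply Finset.card_le_card
    intro Y hY
    rw [mem_shq_coV]
    rw [Finset.mem_union, Finset.mem_biUnion] at hY
    rcases hY with hY | ⟨X, hX, hY⟩
    · rw [hE0, Finset.mem_filter, Finset.mem_powersetCard] at hY
      exact ⟨X0, hX0, hY.1.1, Finset.disjoint_of_subset_right (hBW X0 hX0) hY.2.2, hY.1.2⟩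
    · simp only [hE, Finset.mem_filter, Finset.mem_powersetCard] at hY
      exact ⟨X, hX, hY.1.1, hY.2.2, hY.1.2⟩
  · rw [Finset.disjoint_left]
    intro Y hY hY'
    rw [Finset.mem_biUnion] at hY'
    obtain ⟨X, hX, hY'⟩ := hY'
    simp only [hE, hE0, Finset.mem_filter] at hY hY'
    obtain ⟨w, hw⟩ := Finset.card_pos.1 (by rw [hWX X hX]; omega)
    exact Finset.disjoint_left.1 hY.2.2 (hY'.2.1 hw) (Finset.mem_sdiff.1 hw).1

theorem Wcase_final (v k a b d : ℕ) (hk : 5 ≤ k) (hv : 2 * k ≤ v) (hb : 3 ≤ b)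
    (hd : (v - (k + 1)).choose (k - 1) + b * (v - (k + 1)).choose (k - 2) ≤ d)
    (ha : a + d ≤ v.choose (k - 1)) :
    a + b + 2 * (v - k).choose (k - 1) < v.choose (k - 1) + (v - k - 2).choose (k - 1) + 2 := by
  obtain ⟨m, hm⟩ : ∃ m, v = m + k + 2 := ⟨v - k - 2, by omega⟩
  obtain ⟨j, hj⟩ : ∃ j, k = j + 3 := ⟨k - 3, by omega⟩
  have e1 : v - (k + 1) = m + 1 := by omega
  have e2 : v - k = m + 1 + 1 := by omega
  have e3 : v - k - 2 = m := by omega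
  have e4 : k - 1 = j + 1 + 1 := by omega
  have e5 : k - 2 = j + 1 := by omega
  rw [e1, e5, e4] at hd
  rw [e2, e4, show m + 1 + 1 - 2 = m by omega]
  rw [e4] at ha
  have p1 := Nat.choose_succ_succ (m+1) (j + 1)
  have p2 := Nat.choose_succ_succ m (j + 1)
  have p3 := Nat.choose_succ_succ m j
  simp only [Nat.succ_eq_add_one] at p1 p2 p3
  have q : 2 ≤ m.choose j := by
    have h1 : (j+1).choose j ≤ m.choose j := Nat.choose_le_choose j (by omega)
    rw [Nat.choose_succ_self_right] at h1
    omega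
  obtain ⟨c, hc⟩ : ∃ c, b = c + 3 := ⟨b - 3, by omega⟩
  have : c ≤ c * (m+1).choose (j+1) := Nat.le_mul_of_pos_right _ (by omega)
  rw [hc, add_mul] at hd
  omega

theorem DM_card (V B1 B2 : Finset ℕ) (k : ℕ) (h1 : B1 ⊆ V) (h2 : B2 ⊆ V)
    (c1 : B1.card = k) (c2 : B2.card = k) :
    (shq (k - 1) (coV V {B1, B2})).card + (V.card - (2 * k - (B1 ∩ B2).card)).choose (k - 1)
      = 2 * (V.card - k).choose (k - 1) := by
  set f := fun X : Finset ℕ => (Finset.powersetCard (k - 1) V).filter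
    (fun Y => ∅ ⊆ Y ∧ Disjoint Y X) with hf
  have hfc : ∀ X ⊆ V, (f X).card = (V.card - X.card).choose (k - 1) := by
    intro X hX
    have := count_between V ∅ X (k - 1) (by simp) hX (by simp) (by simp)
    simp only [hf]; rw [this]; simp
  have e1 : shq (k - 1) (coV V {B1, B2}) = f B1 ∪ f B2 := by
    ext Y
    rw [mem_shq_coV]
    simp [hf, Finset.mem_filter, Finset.mem_powersetCard]
    tauto
  have e2 : f (B1 ∪ B2) = f B1 ∩ f B2 := by
    ext Y
    simp only [hf, Finset.mem_filter, Finset.mem_inter, Finset.disjoint_union_right]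
    tauto
  have e3 : (B1 ∪ B2).card = 2 * k - (B1 ∩ B2).card := by
    have := Finset.card_union_add_card_inter B1 B2
    omega
  rw [e1, ← e3, ← hfc _ (Finset.union_subset h1 h2), e2, Finset.card_union_add_card_inter,
    hfc B1 h1, hfc B2 h2, c1, c2]
  ring


noncomputable def msel (p q : ℕ) (A : Finset ℕ) : ℕ :=
  if p ∈ A then p else if q ∈ A then q else sInf (A : Set ℕ)

theorem msel_mem (p q : ℕ) (A : Finset ℕ) (h : A.Nonempty) : msel p q A ∈ A := by
  unfold msel
  split_ifs with h1 h2
  · exact h1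
  · exact h2
  · have := Nat.sInf_mem (s := (A : Set ℕ)) (by exact_mod_cast h)
    exact_mod_cast this

theorem msel_cons (p q : ℕ) (A A' : Finset ℕ) (hA : A' ⊆ A) (h : msel p q A ∈ A') :
    msel p q A' = msel p q A := by
  by_cases h1 : p ∈ A
  · have e : msel p q A = p := by simp [msel, h1]
    rw [e] at h ⊢
    simp [msel, h]
  have h1' : p ∉ A' := fun x => h1 (hA x)
  by_cases h2 : q ∈ A
  · have e : msel p q A = q := by simp [msel, h1, h2]
    rw [e] at h ⊢
    simp [msel, h, h1']
  have h2' : q ∉ A' := fun x => h2 (hA x)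
  have e : msel p q A = sInf (A : Set ℕ) := by simp [msel, h1, h2]
  have e' : msel p q A' = sInf (A' : Set ℕ) := by simp [msel, h1', h2']
  rw [e] at h ⊢
  rw [e']
  apply le_antisymm
  · exact Nat.sInf_le (by exact_mod_cast h)
  · apply Nat.sInf_le
    have := Nat.sInf_mem (s := (A' : Set ℕ)) ⟨_, h⟩
    exact hA (by exact_mod_cast this)

theorem exists_pq (V B1 B2 : Finset ℕ) (k : ℕ) (B : Finset (Finset ℕ))
    (hB : B ⊆ Finset.powersetCard k V) (h1 : B1 ∈ B) (h2 : B2 ∈ B)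
    (hk : 5 ≤ k) (hs : (B1 ∩ B2).card + 2 ≤ k)
    (hγ : B.card < (V.card - 3).choose (k - 3)) :
    ∃ p1 ∈ B1 \ B2, ∃ q1 ∈ B2 \ B1, (B1 ∩ B2).card = 3 →
      ∃ X0 ∈ Finset.powersetCard k V, B1 ∩ B2 ⊆ X0 ∧ p1 ∉ X0 ∧ q1 ∉ X0 ∧ X0 ∉ B := by
  have hBc : ∀ X ∈ B, X ⊆ V ∧ X.card = k := fun X hX => Finset.mem_powersetCard.1 (hB hX)
  have hP : (B1 \ B2).Nonempty := by
    rw [← Finset.card_pos]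
    have := Finset.card_sdiff_add_card_inter B1 B2
    have := (hBc B1 h1).2
    omega
  have hQ : (B2 \ B1).Nonempty := by
    rw [← Finset.card_pos]
    have := Finset.card_sdiff_add_card_inter B2 B1
    rw [Finset.inter_comm] at this
    have := (hBc B2 h2).2
    omega
  by_contra hcon
  push Not at hcon
  obtain ⟨p0, hp0⟩ := hP
  obtain ⟨q0, hq0⟩ := hQ
  have hs3 := (hcon p0 hp0 q0 hq0).1
  have hsub : (Finset.powersetCard k V).filter (fun X => B1 ∩ B2 ⊆ X) ⊆ B := by
    intro X hX
    rw [Finset.mem_filter] at hX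
    have hXc := (Finset.mem_powersetCard.1 hX.1).2
    by_cases e1 : X = B1
    · rw [e1]; exact h1
    by_cases e2 : X = B2
    · rw [e2]; exact h2
    have a1 : ∃ p ∈ B1 \ B2, p ∉ X := by
      by_contra hc
      push Not at hc
      apply e1
      symm
      apply Finset.eq_of_subset_of_card_le _ (by rw [hXc, (hBc B1 h1).2])
      intro x hx
      by_cases hx2 : x ∈ B2
      · exact hX.2 (Finset.mem_inter.2 ⟨hx, hx2⟩)
      · exact hc x (Finset.mem_sdiff.2 ⟨hx, hx2⟩)
    have a2 : ∃ q ∈ B2 \ B1, q ∉ X := by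
      by_contra hc
      push Not at hc
      apply e2
      symm
      apply Finset.eq_of_subset_of_card_le _ (by rw [hXc, (hBc B2 h2).2])
      intro x hx
      by_cases hx2 : x ∈ B1
      · exact hX.2 (Finset.mem_inter.2 ⟨hx2, hx⟩)
      · exact hc x (Finset.mem_sdiff.2 ⟨hx, hx2⟩)
    obtain ⟨p, hp, hpX⟩ := a1
    obtain ⟨q, hq, hqX⟩ := a2
    exact (hcon p hp q hq).2 X hX.1 hX.2 hpX hqX
  have := Finset.card_le_card hsub
  rw [count_above V (B1 ∩ B2) k (Finset.inter_subset_left.trans (hBc B1 h1).1) (by omega), hs3]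
    at this
  omega

theorem choose_two_lt (v : ℕ) (hv : 10 ≤ v) : v - 2 < (v - 5).choose 2 := by
  obtain ⟨m, rfl⟩ : ∃ m, v = m + 10 := ⟨v - 10, by omega⟩
  rw [show m + 10 - 2 = m + 8 by omega, show m + 10 - 5 = m + 5 by omega, Nat.choose_two_right,
    show m + 5 - 1 = m + 4 by omega]
  rw [Nat.lt_iff_add_one_le, Nat.le_div_iff_mul_le (by norm_num)]
  nlinarith

theorem choose_half {n r s : ℕ} (hrs : r ≤ s) (hs : s ≤ n / 2) : n.choose r ≤ n.choose s := by
  induction s, hrs using Nat.le_induction with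
  | base => exact le_rfl
  | succ m hm ih => exact (ih (by omega)).trans (Nat.choose_le_succ_of_lt_half_left (by omega))

theorem choose_mono_right {n r s : ℕ} (hrs : r ≤ s) (hs : r + s ≤ n) :
    n.choose r ≤ n.choose s := by
  by_cases h : s ≤ n / 2
  · exact choose_half hrs h
  · rw [← Nat.choose_symm (by omega : s ≤ n)]
    exact choose_half (by omega) (by omega)

theorem choose_two_le (m j : ℕ) (hj : 2 ≤ j) (hm : j + 2 ≤ m) : m.choose 2 ≤ m.choose j :=
  choose_mono_right hj (by omega)

theorem pq_fiber (V B1 B2 : Finset ℕ) (k p q p1 q1 : ℕ) (B Φ : Finset (Finset ℕ))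
    (hB : B ⊆ Finset.powersetCard k V) (h1 : B1 ∈ B) (h2 : B2 ∈ B)
    (hk : 5 ≤ k) (hv : 2 * k ≤ V.card) (hs : (B1 ∩ B2).card + 2 ≤ k)
    (hmax : ∀ X ∈ B, ∀ Y ∈ B, (X ∩ Y).card + 2 ≤ k → (X ∩ Y).card ≤ (B1 ∩ B2).card)
    (hp1 : p1 ∈ B1 \ B2) (hq1 : q1 ∈ B2 \ B1)
    (hfull : (B1 ∩ B2).card = 3 →
      ∃ X0 ∈ Finset.powersetCard k V, B1 ∩ B2 ⊆ X0 ∧ p1 ∉ X0 ∧ q1 ∉ X0 ∧ X0 ∉ B)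
    (hp : p ∈ B1 \ B2) (hq : q ∈ B2 \ B1) (hΦ : Φ ⊆ B)
    (hS : ∀ X ∈ Φ, B1 ∩ B2 ⊆ X) (hpX : ∀ X ∈ Φ, p ∉ X) (hqX : ∀ X ∈ Φ, q ∉ X)
    (hp1X : p ≠ p1 → ∀ X ∈ Φ, p1 ∈ X) (hq1X : q ≠ q1 → ∀ X ∈ Φ, q1 ∈ X) :
    Φ.card < (V.card - 5).choose (V.card - 2 - k) := by
  have hBc : ∀ X ∈ B, X ⊆ V ∧ X.card = k := fun X hX => Finset.mem_powersetCard.1 (hB hX)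
  have hSV : B1 ∩ B2 ⊆ V := Finset.inter_subset_left.trans (hBc B1 h1).1
  rw [Finset.mem_sdiff] at hp hq hp1 hq1
  have hpq : p ≠ q := by rintro rfl; exact hp.2 hq.1
  have hpqV : ({p, q} : Finset ℕ) ⊆ V := by
    intro x hx
    simp only [Finset.mem_insert, Finset.mem_singleton] at hx
    rcases hx with rfl | rfl
    · exact (hBc B1 h1).1 hp.1
    · exact (hBc B2 h2).1 hq.1
  have hpqc : ({p, q} : Finset ℕ).card = 2 := Finset.card_pair hpq
  have gen : ∀ S' : Finset ℕ, S' ⊆ V → p ∉ S' → q ∉ S' → S'.card ≤ k → (∀ X ∈ Φ, S' ⊆ X) →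
      Φ ⊆ (Finset.powersetCard k V).filter (fun X => S' ⊆ X ∧ Disjoint X {p, q}) ∧
      ((Finset.powersetCard k V).filter (fun X => S' ⊆ X ∧ Disjoint X {p, q})).card
        = (V.card - S'.card - 2).choose (k - S'.card) := by
    intro S' hS'V hpS hqS hc hall
    constructor
    · intro X hX
      rw [Finset.mem_filter]
      refine ⟨hB (hΦ hX), hall X hX, ?_⟩
      simp [hpX X hX, hqX X hX]
    · rw [count_between V S' {p, q} k hS'V hpqV (by simp [hpS, hqS]) hc, hpqc]
  have gen4 : ∀ S' : Finset ℕ, S' ⊆ V → p ∉ S' → q ∉ S' → S'.card ≤ k → 4 ≤ S'.card →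
      (∀ X ∈ Φ, S' ⊆ X) → Φ.card < (V.card - 5).choose (V.card - 2 - k) := by
    intro S' hS'V hpS hqS hc h4 hall
    obtain ⟨g1, g2⟩ := gen S' hS'V hpS hqS hc hall
    have := Finset.card_le_card g1
    rw [g2] at this
    refine lt_of_le_of_lt this ?_
    have e1 : (V.card - S'.card - 2).choose (k - S'.card)
        = (V.card - S'.card - 2).choose (V.card - 2 - k) := by
      rw [← Nat.choose_symm (by omega)]; congr 1; omega
    rw [e1]
    have e2 : (V.card - S'.card - 2).choose (V.card - 2 - k)
        ≤ (V.card - 6).choose (V.card - 2 - k) := Nat.choose_le_choose _ (by omega)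
    refine lt_of_le_of_lt e2 ?_
    obtain ⟨a, ha⟩ : ∃ a, V.card = a + 6 := ⟨V.card - 6, by omega⟩
    obtain ⟨b, hb⟩ : ∃ b, V.card - 2 - k = b + 1 := ⟨V.card - 2 - k - 1, by omega⟩
    rw [hb, show V.card - 6 = a by omega, show V.card - 5 = a + 1 by omega,
      Nat.choose_succ_succ]
    have : 0 < a.choose b := Nat.choose_pos (by omega)
    simp only [Nat.succ_eq_add_one]
    omega
  have hpS : p ∉ B1 ∩ B2 := fun h => hp.2 (Finset.mem_inter.1 h).2
  have hqS : q ∉ B1 ∩ B2 := fun h => hq.2 (Finset.mem_inter.1 h).1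
  rcases lt_trichotomy (B1 ∩ B2).card 3 with h | h | h
  · -- small s
    obtain ⟨s, hsdef⟩ : ∃ s, s = (B1 ∩ B2).card := ⟨_, rfl⟩
    set S := B1 ∩ B2 with hSdef
    set G := Φ.image (fun X => X \ S) with hG
    have hGc : G.card = Φ.card := by
      apply Finset.card_image_of_injOn
      intro X hX Y hY hXY
      have := congrArg (fun Z => S ∪ Z) hXY
      simpa [Finset.union_sdiff_of_subset (hS X hX), Finset.union_sdiff_of_subset (hS Y hY)]
        using this
    have hcnt := count_lem (k - s) (by omega) (V \ {p, q}).card (V \ {p, q}) G rfl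
      (by
        intro Z hZ
        rw [hG, Finset.mem_image] at hZ
        obtain ⟨X, hX, rfl⟩ := hZ
        rw [Finset.mem_powersetCard, Finset.card_sdiff_of_subset (hS X hX),
          (hBc X (hΦ hX)).2, ← hsdef]
        refine ⟨?_, rfl⟩
        intro x hx
        rw [Finset.mem_sdiff] at hx
        rw [Finset.mem_sdiff]
        refine ⟨(hBc X (hΦ hX)).1 hx.1, ?_⟩
        simp only [Finset.mem_insert, Finset.mem_singleton]
        rintro (rfl | rfl)
        · exact hpX X hX hx.1
        · exact hqX X hX hx.1)
      (by
        intro Z hZ Z' hZ' hne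
        rw [hG, Finset.mem_image] at hZ hZ'
        obtain ⟨X, hX, rfl⟩ := hZ
        obtain ⟨Y, hY, rfl⟩ := hZ'
        have hXY : X ≠ Y := by rintro rfl; exact hne rfl
        have e1 : (X \ S) ∩ (Y \ S) = (X ∩ Y) \ S := by
          ext x; simp only [Finset.mem_inter, Finset.mem_sdiff]; tauto
        have e2 : S ⊆ X ∩ Y := Finset.subset_inter (hS X hX) (hS Y hY)
        have e3 := Finset.card_le_card e2
        rw [e1, Finset.card_sdiff_of_subset e2, ← hsdef]
        have e4 : (X ∩ Y).card < k := by
          rw [← (hBc X (hΦ hX)).2]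
          apply Finset.card_lt_card
          refine ⟨Finset.inter_subset_left, fun h => hXY ?_⟩
          apply Finset.eq_of_subset_of_card_le (h.trans Finset.inter_subset_right)
          rw [(hBc X (hΦ hX)).2, (hBc Y (hΦ hY)).2]
        by_cases h5 : (X ∩ Y).card + 2 ≤ k
        · have := hmax X (hΦ hX) Y (hΦ hY) h5
          left; omega
        · right; omega)
    rw [hGc, Finset.card_sdiff_of_subset hpqV, hpqc] at hcnt
    have e1 := choose_two_lt V.card (by omega)
    have e2 := choose_two_le (V.card - 5) (V.card - 2 - k)
    have e3 : (V.card - 5).choose 2 ≤ (V.card - 5).choose (k - 3) :=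
      choose_two_le _ _ (by omega) (by omega)
    rw [← Nat.choose_symm (by omega : k - 3 ≤ V.card - 5),
      show V.card - 5 - (k - 3) = V.card - 2 - k by omega] at e3
    omega
  · by_cases hpp : p = p1
    · by_cases hqq : q = q1
      · obtain ⟨X0, hX0, hSX0, hp0, hq0, hX0B⟩ := hfull h
        obtain ⟨g1, g2⟩ := gen (B1 ∩ B2) hSV hpS hqS (by omega) hS
        have : Φ ⊂ (Finset.powersetCard k V).filter
            (fun X => B1 ∩ B2 ⊆ X ∧ Disjoint X {p, q}) := by
          rw [Finset.ssubset_iff_of_subset g1]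
          refine ⟨X0, ?_, fun h => hX0B (hΦ h)⟩
          rw [Finset.mem_filter]
          refine ⟨hX0, hSX0, ?_⟩
          rw [hpp, hqq]
          simp [hp0, hq0]
        have := Finset.card_lt_card this
        rw [g2, h] at this
        rw [← Nat.choose_symm (by omega), show V.card - 3 - 2 = V.card - 5 by omega,
          show V.card - 5 - (k - 3) = V.card - 2 - k by omega] at this
        exact this
      · apply gen4 (insert q1 (B1 ∩ B2))
        · exact Finset.insert_subset ((hBc B2 h2).1 hq1.1) hSV
        · simp only [Finset.mem_insert, not_or]
          exact ⟨fun e => hq1.2 (e ▸ hp.1), hpS⟩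
        · simp only [Finset.mem_insert, not_or]
          exact ⟨hqq, hqS⟩
        · exact (Finset.card_insert_le _ _).trans (by omega)
        · rw [Finset.card_insert_of_notMem (fun h => hq1.2 (Finset.mem_inter.1 h).1)]; omega
        · intro X hX
          exact Finset.insert_subset (hq1X hqq X hX) (hS X hX)
    · apply gen4 (insert p1 (B1 ∩ B2))
      · exact Finset.insert_subset ((hBc B1 h1).1 hp1.1) hSV
      · simp only [Finset.mem_insert, not_or]
        exact ⟨hpp, hpS⟩
      · simp only [Finset.mem_insert, not_or]
        exact ⟨fun e => hp1.2 (e ▸ hq.1), hqS⟩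
      · exact (Finset.card_insert_le _ _).trans (by omega)
      · rw [Finset.card_insert_of_notMem (fun h => hp1.2 (Finset.mem_inter.1 h).2)]; omega
      · intro X hX
        exact Finset.insert_subset (hp1X hpp X hX) (hS X hX)
  · exact gen4 (B1 ∩ B2) hSV hpS hqS (by omega) (by omega) hS


theorem main_c (V B1 B2 : Finset ℕ) (k : ℕ) (B : Finset (Finset ℕ))
    (hB : B ⊆ Finset.powersetCard k V) (h1 : B1 ∈ B) (h2 : B2 ∈ B)
    (hk : 5 ≤ k) (hv : 2 * k ≤ V.card) (hs : (B1 ∩ B2).card + 2 ≤ k)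
    (hmax : ∀ X ∈ B, ∀ Y ∈ B, (X ∩ Y).card + 2 ≤ k → (X ∩ Y).card ≤ (B1 ∩ B2).card)
    (hγ : B.card < (V.card - 3).choose (k - 3)) (hne : (B \ {B1, B2}).Nonempty) :
    (B \ {B1, B2}).card <
      (shq (k - 1) (coV V B) \ shq (k - 1) (coV V {B1, B2})).card := by
  obtain ⟨p1, hp1, q1, hq1, hfull⟩ := exists_pq V B1 B2 k B hB h1 h2 hk hs hγ
  have hBc : ∀ X ∈ B, X ⊆ V ∧ X.card = k := fun X hX => Finset.mem_powersetCard.1 (hB hX)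
  have hRB : ∀ X ∈ B \ {B1, B2}, X ∈ B ∧ X ≠ B1 ∧ X ≠ B2 := by
    intro X hX
    simp only [Finset.mem_sdiff, Finset.mem_insert, Finset.mem_singleton, not_or] at hX
    exact hX
  set S := B1 ∩ B2 with hSdef
  set P := B1 \ B2 with hPdef
  set Q := B2 \ B1 with hQdef
  set m := msel p1 q1 with hm
  set lab := fun X : Finset ℕ => if S ⊆ X then ({m (P \ X), m (Q \ X)} : Finset ℕ)
    else {m (S \ X)} with hlab
  set labY := fun Y : Finset ℕ => if S ∩ Y = ∅ then ({m (P ∩ Y), m (Q ∩ Y)} : Finset ℕ)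
    else {m (S ∩ Y)} with hlabY
  have hPne : ∀ X ∈ B \ {B1, B2}, S ⊆ X → m (P \ X) ∈ P \ X := by
    intro X hX hSX
    apply msel_mem
    by_contra hcon
    rw [Finset.not_nonempty_iff_eq_empty, Finset.sdiff_eq_empty_iff_subset] at hcon
    apply (hRB X hX).2.1
    symm
    apply Finset.eq_of_subset_of_card_le _ (by rw [(hBc X (hRB X hX).1).2, (hBc B1 h1).2])
    intro x hx
    by_cases hx2 : x ∈ B2
    · exact hSX (Finset.mem_inter.2 ⟨hx, hx2⟩)
    · exact hcon (Finset.mem_sdiff.2 ⟨hx, hx2⟩)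
  have hQne : ∀ X ∈ B \ {B1, B2}, S ⊆ X → m (Q \ X) ∈ Q \ X := by
    intro X hX hSX
    apply msel_mem
    by_contra hcon
    rw [Finset.not_nonempty_iff_eq_empty, Finset.sdiff_eq_empty_iff_subset] at hcon
    apply (hRB X hX).2.2
    symm
    apply Finset.eq_of_subset_of_card_le _ (by rw [(hBc X (hRB X hX).1).2, (hBc B2 h2).2])
    intro x hx
    by_cases hx2 : x ∈ B1
    · exact hSX (Finset.mem_inter.2 ⟨hx2, hx⟩)
    · exact hcon (Finset.mem_sdiff.2 ⟨hx, hx2⟩)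
  have hSne : ∀ X, ¬ S ⊆ X → m (S \ X) ∈ S \ X := by
    intro X hSX
    apply msel_mem
    rw [Finset.nonempty_iff_ne_empty, Ne, Finset.sdiff_eq_empty_iff_subset]
    exact hSX
  have hlab1 : ∀ X, S ⊆ X → lab X = {m (P \ X), m (Q \ X)} := fun X h => by simp [hlab, h]
  have hlab2 : ∀ X, ¬ S ⊆ X → lab X = {m (S \ X)} := fun X h => by simp [hlab, h]
  have hne12 : ∀ X ∈ B \ {B1, B2}, S ⊆ X → m (P \ X) ≠ m (Q \ X) := by
    intro X hX hSX e
    have a := hPne X hX hSX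
    have b := hQne X hX hSX
    rw [e] at a
    simp only [hPdef, hQdef, Finset.mem_sdiff] at a b
    exact a.1.2 b.1.1
  have hlc1 : ∀ X ∈ B \ {B1, B2}, S ⊆ X → (lab X).card = 2 := by
    intro X hX hSX
    rw [hlab1 X hSX, Finset.card_pair (hne12 X hX hSX)]
  have hlc2 : ∀ X, ¬ S ⊆ X → (lab X).card = 1 := by
    intro X hSX
    rw [hlab2 X hSX, Finset.card_singleton]
  have hV1 := (hBc B1 h1).1
  have hV2 := (hBc B2 h2).1
  have hld : ∀ X ∈ B \ {B1, B2}, Disjoint (lab X) X := by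
    intro X hX
    by_cases hSX : S ⊆ X
    · rw [hlab1 X hSX]
      have a := (Finset.mem_sdiff.1 (hPne X hX hSX)).2
      have b := (Finset.mem_sdiff.1 (hQne X hX hSX)).2
      simp [a, b]
    · rw [hlab2 X hSX]
      have a := (Finset.mem_sdiff.1 (hSne X hSX)).2
      simp [a]
  have hlV : ∀ X ∈ B \ {B1, B2}, lab X ⊆ V := by
    intro X hX
    by_cases hSX : S ⊆ X
    · rw [hlab1 X hSX]
      have a := (Finset.mem_sdiff.1 (hPne X hX hSX)).1
      have b := (Finset.mem_sdiff.1 (hQne X hX hSX)).1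
      intro x hx
      simp only [Finset.mem_insert, Finset.mem_singleton] at hx
      rcases hx with rfl | rfl
      · exact hV1 (Finset.mem_sdiff.1 a).1
      · exact hV2 (Finset.mem_sdiff.1 b).1
    · rw [hlab2 X hSX]
      have a := (Finset.mem_sdiff.1 (hSne X hSX)).1
      rw [Finset.singleton_subset_iff]
      exact hV1 (Finset.mem_inter.1 a).1
  have hl12 : ∀ X ∈ B \ {B1, B2}, (∃ x ∈ lab X, x ∈ B1) ∧ (∃ x ∈ lab X, x ∈ B2) := by
    intro X hX
    by_cases hSX : S ⊆ X
    · rw [hlab1 X hSX]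
      have a := (Finset.mem_sdiff.1 (hPne X hX hSX)).1
      have b := (Finset.mem_sdiff.1 (hQne X hX hSX)).1
      exact ⟨⟨_, by simp, (Finset.mem_sdiff.1 a).1⟩,
        ⟨m (Q \ X), by simp, (Finset.mem_sdiff.1 b).1⟩⟩
    · rw [hlab2 X hSX]
      have a := (Finset.mem_sdiff.1 (hSne X hSX)).1
      exact ⟨⟨_, Finset.mem_singleton_self _, (Finset.mem_inter.1 a).1⟩,
        ⟨_, Finset.mem_singleton_self _, (Finset.mem_inter.1 a).2⟩⟩
  have hlY : ∀ X ∈ B \ {B1, B2}, ∀ Y, lab X ⊆ Y → Disjoint Y X → labY Y = lab X := by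
    intro X hX Y hY hYX
    have sub : ∀ A : Finset ℕ, A ∩ Y ⊆ A \ X := by
      intro A x hx
      rw [Finset.mem_inter] at hx
      exact Finset.mem_sdiff.2 ⟨hx.1, Finset.disjoint_left.1 hYX hx.2⟩
    by_cases hSX : S ⊆ X
    · rw [hlab1 X hSX] at hY ⊢
      have e : S ∩ Y = ∅ := by
        rw [← Finset.disjoint_iff_inter_eq_empty]
        exact (Finset.disjoint_of_subset_right hSX hYX).symm
      simp only [hlabY, e, if_true]
      have a := (Finset.mem_sdiff.1 (hPne X hX hSX)).1
      have b := (Finset.mem_sdiff.1 (hQne X hX hSX)).1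
      rw [hm, msel_cons p1 q1 (P \ X) (P ∩ Y) (sub P)
          (Finset.mem_inter.2 ⟨a, hY (by simp [hm])⟩),
        msel_cons p1 q1 (Q \ X) (Q ∩ Y) (sub Q)
          (Finset.mem_inter.2 ⟨b, hY (by simp [hm])⟩)]
    · rw [hlab2 X hSX] at hY ⊢
      have a := (Finset.mem_sdiff.1 (hSne X hSX)).1
      have a' : m (S \ X) ∈ S ∩ Y := Finset.mem_inter.2 ⟨a, hY (by simp)⟩
      have e : S ∩ Y ≠ ∅ := Finset.nonempty_iff_ne_empty.1 ⟨_, a'⟩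
      simp only [hlabY, e, if_false]
      rw [hm, msel_cons p1 q1 (S \ X) (S ∩ Y) (sub S) a']
  refine label_sum (B \ {B1, B2}) lab
    (fun T => EE V T k ((B \ {B1, B2}).filter (fun X => lab X = T))) _ labY hne ?_ ?_ ?_
  · intro T hT
    rw [Finset.mem_image] at hT
    obtain ⟨X0, hX0, rfl⟩ := hT
    have hfB : ∀ X ∈ (B \ {B1, B2}).filter (fun X => lab X = lab X0),
        X ∈ B \ {B1, B2} ∧ lab X = lab X0 := fun X hX => Finset.mem_filter.1 hX
    have hcard2 : (lab X0).card ≤ 2 := by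
      by_cases hSX : S ⊆ X0
      · rw [hlc1 X0 hX0 hSX]
      · rw [hlc2 X0 hSX]; omega
    apply EE_lt V (lab X0) k _ hv (hlV X0 hX0) (by omega)
    · exact fun X hX => hB (hRB X (hfB X hX).1).1
    · intro X hX
      rw [← (hfB X hX).2]
      exact hld X (hfB X hX).1
    · exact ⟨X0, Finset.mem_filter.2 ⟨hX0, rfl⟩⟩
    · by_cases hSX : S ⊆ X0
      · rw [hlc1 X0 hX0 hSX, show V.card - 2 * 2 - 1 = V.card - 5 by omega]
        have hfS : ∀ X ∈ (B \ {B1, B2}).filter (fun X => lab X = lab X0), S ⊆ X := by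
          intro X hX
          by_contra hcon
          have e1 := hlc2 X hcon
          rw [(hfB X hX).2, hlc1 X0 hX0 hSX] at e1
          omega
        have a := Finset.mem_sdiff.1 (hPne X0 hX0 hSX)
        have b := Finset.mem_sdiff.1 (hQne X0 hX0 hSX)
        have hfe : ∀ X ∈ (B \ {B1, B2}).filter (fun X => lab X = lab X0),
            m (P \ X) = m (P \ X0) ∧ m (Q \ X) = m (Q \ X0) := by
          intro X hX
          have e := (hfB X hX).2
          rw [hlab1 X (hfS X hX), hlab1 X0 hSX] at e
          have a' := Finset.mem_sdiff.1 (hPne X (hfB X hX).1 (hfS X hX))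
          have b' := Finset.mem_sdiff.1 (hQne X (hfB X hX).1 (hfS X hX))
          have c1 : m (P \ X) ∈ ({m (P \ X0), m (Q \ X0)} : Finset ℕ) := by rw [← e]; simp
          have c2 : m (Q \ X) ∈ ({m (P \ X0), m (Q \ X0)} : Finset ℕ) := by rw [← e]; simp
          simp only [Finset.mem_insert, Finset.mem_singleton] at c1 c2
          have d : ∀ y, y ∈ P → y ∈ Q → False := by
            intro y hy hy'
            exact (Finset.mem_sdiff.1 hy).2 (Finset.mem_sdiff.1 hy').1
          constructor
          · rcases c1 with c1 | c1
            · exact c1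
            · exact absurd b.1 (fun h => d _ (c1 ▸ a'.1) h)
          · rcases c2 with c2 | c2
            · exact absurd a.1 (fun h => d _ h (c2 ▸ b'.1))
            · exact c2
        refine pq_fiber V B1 B2 k (m (P \ X0)) (m (Q \ X0)) p1 q1 B _ hB h1 h2 hk hv hs hmax hp1
          hq1 hfull a.1 b.1 (fun X hX => (hRB X (hfB X hX).1).1) hfS ?_ ?_ ?_ ?_
        · intro X hX
          rw [← (hfe X hX).1]
          exact (Finset.mem_sdiff.1 (hPne X (hfB X hX).1 (hfS X hX))).2
        · intro X hX
          rw [← (hfe X hX).2]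
          exact (Finset.mem_sdiff.1 (hQne X (hfB X hX).1 (hfS X hX))).2
        · intro hne' X hX
          by_contra hcon
          apply hne'
          rw [← (hfe X hX).1, hm]
          have : p1 ∈ P \ X := Finset.mem_sdiff.2 ⟨hp1, hcon⟩
          simp only [msel, this, if_true]
        · intro hne' X hX
          by_contra hcon
          apply hne'
          rw [← (hfe X hX).2, hm]
          have : q1 ∈ Q \ X := Finset.mem_sdiff.2 ⟨hq1, hcon⟩
          have hn : p1 ∉ Q \ X := by
            intro h
            exact (Finset.mem_sdiff.1 (Finset.mem_sdiff.1 h).1).2 (Finset.mem_sdiff.1 hp1).1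
          simp only [msel, this, hn, if_true, if_false]
      · rw [hlc2 X0 hSX]
        have e1 : ((B \ {B1, B2}).filter (fun X => lab X = lab X0)).card ≤ B.card :=
          Finset.card_le_card (fun X hX => (hRB X (hfB X hX).1).1)
        have e2 : (V.card - 3).choose (k - 3) ≤ (V.card - 3).choose (k - 2) :=
          choose_mono_right (by omega) (by omega)
        rw [← Nat.choose_symm (by omega : k - 2 ≤ V.card - 3)] at e2
        rw [show V.card - 2 * 1 - 1 = V.card - 3 by omega,
          show V.card - 1 - k = V.card - 3 - (k - 2) by omega]
        omega
  · intro T hT Y hY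
    rw [Finset.mem_image] at hT
    obtain ⟨X0, hX0, rfl⟩ := hT
    simp only [EE, Finset.mem_filter, Finset.mem_powersetCard] at hY
    obtain ⟨⟨hYV, hYc⟩, hTY, X, hX, hYX⟩ := hY
    rw [Finset.mem_sdiff, mem_shq_coV, mem_shq_coV]
    refine ⟨⟨X, (hRB X hX.1).1, hYV, hYX, hYc⟩, ?_⟩
    rintro ⟨Z, hZ, _, hYZ, _⟩
    obtain ⟨⟨x, hx, hx1⟩, ⟨y, hy, hy2⟩⟩ := hl12 X0 hX0
    simp only [Finset.mem_insert, Finset.mem_singleton] at hZ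
    rcases hZ with rfl | rfl
    · exact Finset.disjoint_left.1 hYZ (hTY hx) hx1
    · exact Finset.disjoint_left.1 hYZ (hTY hy) hy2
  · intro T hT Y hY
    simp only [EE, Finset.mem_filter, Finset.mem_powersetCard] at hY
    obtain ⟨⟨hYV, hYc⟩, hTY, X, hX, hYX⟩ := hY
    rw [← hX.2] at hTY ⊢
    exact hlY X hX.1 Y hTY hYX

theorem regime1 (V : Finset ℕ) (k : ℕ) (A B : Finset (Finset ℕ)) (hk : 5 ≤ k)
    (hv : 2 * k ≤ V.card) (hA : A ⊆ Finset.powersetCard (k - 1) V)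
    (hB : B ⊆ Finset.powersetCard k V) (hc : ∀ Y ∈ A, ∀ X ∈ B, (Y ∩ X).Nonempty)
    (hγ : B.card < (V.card - 3).choose (k - 3)) :
    (∃ K ⊆ V, K.card = k - 1 ∧ ∀ X ∈ B, K ⊆ X) ∨
    (∃ B1 B2, B1 ≠ B2 ∧ B = {B1, B2} ∧ (B1 ∩ B2).card + 2 ≤ k) ∨
    A.card + B.card + 2 * (V.card - k).choose (k - 1)
      < V.card.choose (k - 1) + (V.card - k - 2).choose (k - 1) + 2 := by
  have hBc : ∀ X ∈ B, X ⊆ V ∧ X.card = k := fun X hX => Finset.mem_powersetCard.1 (hB hX)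
  have hcb := cross_bound V A B (k - 1) hA hc
  rcases B.eq_empty_or_nonempty with rfl | hBne
  · left
    obtain ⟨K, hKV, hK⟩ := Finset.exists_subset_card_eq (s := V) (n := k - 1) (by omega)
    exact ⟨K, hKV, hK, by simp⟩
  by_cases hp : ∀ X ∈ B, ∀ Y ∈ B, X ≠ Y → (X ∩ Y).card = k - 1
  · rcases struct_lem B k (by omega) (fun X hX => (hBc X hX).2) hBne hp with h | h
    · obtain ⟨K, hKc, hK⟩ := h
      obtain ⟨X, hX⟩ := hBne
      exact Or.inl ⟨K, (hK X hX).trans (hBc X hX).1, hKc, hK⟩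
    · obtain ⟨h3, B1, hB1, B2, hB2, hW, hall⟩ := h
      right; right
      rcases Wcase_D V (B1 ∪ B2) k B (by omega) hB
        (Finset.union_subset (hBc B1 hB1).1 (hBc B2 hB2).1) hW hall with h | h
      · exact Wcase_final V.card k A.card B.card _ hk hv h3 h hcb
      · exact absurd h hBne.ne_empty
  · push Not at hp
    obtain ⟨X, hX, Y, hY, hXY, hXYc⟩ := hp
    have hcap : ∀ X ∈ B, ∀ Y ∈ B, X ≠ Y → (X ∩ Y).card < k := by
      intro X hX Y hY hne
      rw [← (hBc X hX).2]
      apply Finset.card_lt_card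
      refine ⟨Finset.inter_subset_left, fun h => hne ?_⟩
      apply Finset.eq_of_subset_of_card_le (h.trans Finset.inter_subset_right)
      rw [(hBc X hX).2, (hBc Y hY).2]
    have h0 := hcap X hX Y hY hXY
    obtain ⟨⟨B1, B2⟩, hBB, hmax⟩ := Finset.exists_max_image
      ((B ×ˢ B).filter (fun Z => (Z.1 ∩ Z.2).card + 2 ≤ k)) (fun Z => (Z.1 ∩ Z.2).card)
      ⟨(X, Y), by rw [Finset.mem_filter, Finset.mem_product]; exact ⟨⟨hX, hY⟩, by simp only; omega⟩⟩
    rw [Finset.mem_filter, Finset.mem_product] at hBB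
    obtain ⟨⟨hB1, hB2⟩, hs⟩ := hBB
    simp only at hB1 hB2 hs hmax
    have hmax' : ∀ X ∈ B, ∀ Y ∈ B, (X ∩ Y).card + 2 ≤ k → (X ∩ Y).card ≤ (B1 ∩ B2).card := by
      intro X hX Y hY h
      exact hmax (X, Y) (by rw [Finset.mem_filter, Finset.mem_product]; exact ⟨⟨hX, hY⟩, h⟩)
    have h12 : B1 ≠ B2 := by
      rintro rfl
      rw [Finset.inter_self, (hBc B1 hB1).2] at hs
      omega
    have hsub : ({B1, B2} : Finset (Finset ℕ)) ⊆ B := by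
      intro Z hZ
      simp only [Finset.mem_insert, Finset.mem_singleton] at hZ
      rcases hZ with rfl | rfl <;> assumption
    right
    rcases (B \ {B1, B2}).eq_empty_or_nonempty with he | hne
    · left
      exact ⟨B1, B2, h12, Finset.Subset.antisymm (Finset.sdiff_eq_empty_iff_subset.1 he) hsub, hs⟩
    · right
      have e1 := main_c V B1 B2 k B hB hB1 hB2 hk hv hs hmax' hγ hne
      have e2 : shq (k - 1) (coV V {B1, B2}) ⊆ shq (k - 1) (coV V B) :=
        shq_mono (Finset.image_subset_image hsub)
      rw [Finset.card_sdiff_of_subset e2, Finset.card_sdiff_of_subset hsub,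
        Finset.card_pair h12] at e1
      have e3 := Finset.card_le_card e2
      have e4 := DM_card V B1 B2 k (hBc B1 hB1).1 (hBc B2 hB2).1 (hBc B1 hB1).2 (hBc B2 hB2).2
      have e5 : (V.card - (2 * k - (B1 ∩ B2).card)).choose (k - 1)
          ≤ (V.card - k - 2).choose (k - 1) := Nat.choose_le_choose _ (by omega)
      have e6 := Finset.card_le_card hsub
      rw [Finset.card_pair h12] at e6
      omega


theorem hArith_aux (j : ℕ) (hj : 1 ≤ j) : ∀ μ, j + 1 ≤ μ → ∀ N, μ + 2 + j ≤ N → μ + 4 ≤ N →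
    N.choose j + (μ + 2).choose (j + 2) + (μ + 1).choose (j + 1) + μ.choose (j + 1)
      ≤ N.choose (j + 2) := by
  induction j, hj using Nat.le_induction with
  | base =>
    intro μ hμ N _ hN
    induction N, hN using Nat.le_induction with
    | base =>
      have a1 := Nat.choose_succ_succ (μ + 3) 2
      have a2 := Nat.choose_succ_succ (μ + 2) 2
      have a3 := Nat.choose_succ_succ (μ + 2) 1
      have a4 := Nat.choose_succ_succ (μ + 1) 1
      have a5 := Nat.choose_succ_succ μ 1
      simp only [Nat.succ_eq_add_one, Nat.reduceAdd, Nat.choose_one_right, add_assoc] at *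
      omega
    | succ N hN ih =>
      have a1 := Nat.choose_succ_succ N 2
      have a2 : 0 < N.choose 2 := Nat.choose_pos (by omega)
      simp only [Nat.succ_eq_add_one, Nat.reduceAdd, Nat.choose_one_right] at *
      have := ih (by omega)
      omega
  | succ j hj ihj =>
    intro μ hμ N hN hN4
    induction N, hN using Nat.le_induction with
    | base =>
      clear hN4
      induction μ, hμ using Nat.le_induction with
      | base =>
        rw [show j + 1 + 1 + 2 + (j + 1) = 2 * j + 5 by ring,
          show j + 1 + 1 + 2 = (j + 3) + 1 by ring, show j + 1 + 2 = j + 3 by ring,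
          Nat.choose_succ_self_right, show j + 1 + 1 + 1 = (j + 2) + 1 by ring,
          show j + 1 + 1 = j + 2 by ring, Nat.choose_succ_self_right, Nat.choose_self]
        have s1 := Nat.choose_succ_right_eq (2 * j + 5) (j + 1)
        have s2 : (2 * j + 5).choose (j + 3) = (2 * j + 5).choose (j + 2) := by
          rw [← Nat.choose_symm (by omega)]; congr 1; omega
        have s3 : (2 * j + 5).choose 2 ≤ (2 * j + 5).choose (j + 1) :=
          choose_mono_right (by omega) (by omega)
        rw [Nat.choose_two_right, show 2 * j + 5 - 1 = (j + 2) * 2 by omega, ← mul_assoc,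
          Nat.mul_div_cancel _ (by norm_num)] at s3
        rw [show 2 * j + 5 - (j + 1) = j + 4 by omega, show j + 1 + 1 = j + 2 by ring] at s1
        rw [s2]
        nlinarith
      | succ μ hμ ih =>
        have e := ihj μ (by omega) (μ + 2 + (j + 1)) (by omega) (by omega)
        have p1 := Nat.choose_succ_succ (μ + 2 + (j + 1)) j
        have p2 := Nat.choose_succ_succ (μ + 2) (j + 2)
        have p3 := Nat.choose_succ_succ (μ + 1) (j + 1)
        have p4 := Nat.choose_succ_succ μ (j + 1)
        have p5 := Nat.choose_succ_succ (μ + 2 + (j + 1)) (j + 2)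
        rw [show μ + 1 + 2 + (j + 1) = (μ + 2 + (j + 1)) + 1 by ring]
        simp only [Nat.succ_eq_add_one, add_assoc, Nat.reduceAdd] at *
        omega
    | succ N hN ih =>
      have := ih (by omega)
      have c : N.choose j ≤ N.choose (j + 2) := choose_mono_right (by omega) (by omega)
      rw [Nat.choose_succ_succ N j, show j + 1 + 2 = (j + 2) + 1 by ring,
        Nat.choose_succ_succ N (j + 2)]
      simp only [Nat.succ_eq_add_one]
      simp only [show j + 1 + 2 = (j + 2) + 1 by ring] at this
      omega

theorem hArith (v k : ℕ) (hk : 5 ≤ k) (hv : 2 * k ≤ v) :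
    2 * (v - k).choose (k - 1) + (v - 3).choose (k - 3)
      ≤ (v - 3).choose (k - 1) + (v - k - 2).choose (k - 1) := by
  obtain ⟨j, rfl⟩ : ∃ j, k = j + 3 := ⟨k - 3, by omega⟩
  obtain ⟨μ, rfl⟩ : ∃ μ, v = μ + 2 + (j + 3) := ⟨v - 2 - (j + 3), by omega⟩
  have := hArith_aux j (by omega) μ (by omega) (μ + 2 + j) (by omega) (by omega)
  rw [show μ + 2 + (j + 3) - (j + 3) = μ + 2 by omega,
    show μ + 2 + (j + 3) - 3 = μ + 2 + j by omega, show j + 3 - 1 = j + 2 by omega,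
    show j + 3 - 3 = j by omega, show μ + 2 - 2 = μ by omega]
  have p1 := Nat.choose_succ_succ (μ + 1) (j + 1)
  have p2 := Nat.choose_succ_succ μ (j + 1)
  simp only [Nat.succ_eq_add_one, show j + 1 + 1 = j + 2 by ring,
    show μ + 1 + 1 = μ + 2 by ring] at p1 p2
  omega


def IntF (F : Finset (Finset ℕ)) : Prop := ∀ A ∈ F, ∀ B ∈ F, (A ∩ B).Nonempty

def ShiftedF (F : Finset (Finset ℕ)) : Prop :=
  ∀ X ∈ F, ∀ i j, 1 ≤ i → i < j → j ∈ X → i ∉ X → insert i (X.erase j) ∈ F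

theorem shq_self_le (G : Finset (Finset ℕ)) (r : ℕ) (hr : ∀ X ∈ G, X.card = r) :
    G.card ≤ (shq r G).card :=
  Finset.card_le_card (fun X hX => mem_shq.2 ⟨X, hX, Finset.Subset.refl _, hr X hX⟩)

theorem ekr_half (k : ℕ) (hk : 2 ≤ k) (V : Finset ℕ) (hV : V.card = 2 * k)
    (F : Finset (Finset ℕ))
    (hF : F ⊆ Finset.powersetCard k V) (hi : IntF F) :
    F.card ≤ 2 * (2 * k - 3).choose (k - 2) + (2 * k - 2).choose (k - 2) := by
  have h1 := cross_bound V F F k hF hi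
  have h2 := shq_self_le (coV V F) k (by
    have := coV_sized hF
    rw [hV, show 2 * k - k = k by omega] at this
    exact this)
  rw [coV_card V F (fun X hX => (Finset.mem_powersetCard.1 (hF hX)).1)] at h2
  rw [hV] at h1
  obtain ⟨j, rfl⟩ : ∃ j, k = j + 2 := ⟨k - 2, by omega⟩
  rw [show 2 * (j + 2) - 3 = 2 * j + 1 by omega, show 2 * (j + 2) - 2 = 2 * j + 2 by omega,
    show j + 2 - 2 = j by omega]
  rw [show 2 * (j + 2) = 2 * j + 4 by ring] at h1
  have p1 := Nat.choose_succ_succ (2 * j + 3) (j + 1)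
  have p2 := Nat.choose_succ_succ (2 * j + 2) j
  have p3 := Nat.choose_succ_succ (2 * j + 2) (j + 1)
  have p4 := Nat.choose_succ_succ (2 * j + 1) j
  have s1 := Nat.choose_symm_half j
  have s2 := Nat.choose_symm_half (j + 1)
  have s3 : (2 * j + 2).choose (j + 2) = (2 * j + 2).choose j := by
    rw [← Nat.choose_symm (by omega)]; congr 1; omega
  simp only [Nat.succ_eq_add_one, add_assoc, Nat.reduceAdd, mul_add, Nat.reduceMul] at *
  omega

theorem base_two (n : ℕ) (F : Finset (Finset ℕ))
    (hF : F ⊆ Finset.powersetCard 2 (Finset.Icc 1 n)) (hi : IntF F) (hs : ShiftedF F)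
    (hγ : 1 ≤ (F.filter (fun X => 1 ∉ X)).card) : F.card ≤ 3 := by
  have hFc : ∀ X ∈ F, X ⊆ Finset.Icc 1 n ∧ X.card = 2 :=
    fun X hX => Finset.mem_powersetCard.1 (hF hX)
  obtain ⟨X, hX⟩ := Finset.card_pos.1 hγ
  rw [Finset.mem_filter] at hX
  have s1 : ∃ X ∈ F, 1 ∉ X ∧ 2 ∈ X := by
    by_cases h2 : 2 ∈ X
    · exact ⟨X, hX.1, hX.2, h2⟩
    obtain ⟨x, hx⟩ := Finset.card_pos.1 (by rw [(hFc X hX.1).2]; omega : 0 < X.card)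
    have hx1 := (hFc X hX.1).1 hx
    rw [Finset.mem_Icc] at hx1
    have : x ≠ 1 := fun h => hX.2 (h ▸ hx)
    have : x ≠ 2 := fun h => h2 (h ▸ hx)
    refine ⟨_, hs X hX.1 2 x (by omega) (by omega) hx h2, ?_, by simp⟩
    simp [hX.2]
  obtain ⟨X, hXF, h1, h2⟩ := s1
  have s2 : ∃ X ∈ F, 1 ∉ X ∧ 2 ∈ X ∧ 3 ∈ X := by
    by_cases h3 : 3 ∈ X
    · exact ⟨X, hXF, h1, h2, h3⟩
    obtain ⟨x, hx⟩ := Finset.card_pos.1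
      (by rw [Finset.card_erase_of_mem h2, (hFc X hXF).2]; omega : 0 < (X.erase 2).card)
    rw [Finset.mem_erase] at hx
    have hx1 := (hFc X hXF).1 hx.2
    rw [Finset.mem_Icc] at hx1
    have : x ≠ 1 := fun h => h1 (h ▸ hx.2)
    have : x ≠ 3 := fun h => h3 (h ▸ hx.2)
    have := hx.1
    refine ⟨_, hs X hXF 3 x (by omega) (by omega) hx.2 h3, ?_, ?_, by simp⟩
    · simp [h1]
    · simp [h2]; omega
  obtain ⟨X, hXF, h1, h2, h3⟩ := s2
  have hXe : X = {2, 3} := by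
    symm
    apply Finset.eq_of_subset_of_card_le
    · intro x hx
      simp only [Finset.mem_insert, Finset.mem_singleton] at hx
      rcases hx with rfl | rfl <;> assumption
    · rw [(hFc X hXF).2]; rfl
  have hsub : F ⊆ Finset.powersetCard 2 {1, 2, 3} := by
    intro Y hY
    rw [Finset.mem_powersetCard]
    refine ⟨?_, (hFc Y hY).2⟩
    intro z hz
    by_contra hz3
    simp only [Finset.mem_insert, Finset.mem_singleton, not_or] at hz3
    have hz1 := (hFc Y hY).1 hz
    rw [Finset.mem_Icc] at hz1
    obtain ⟨w, hw⟩ := hi Y hY X hXF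
    rw [Finset.mem_inter, hXe] at hw
    simp only [Finset.mem_insert, Finset.mem_singleton] at hw
    have hwz : w ≠ z := by rintro rfl; omega
    have hYe : Y = {w, z} := by
      symm
      apply Finset.eq_of_subset_of_card_le
      · intro x hx
        simp only [Finset.mem_insert, Finset.mem_singleton] at hx
        rcases hx with rfl | rfl
        · exact hw.1
        · exact hz
      · rw [(hFc Y hY).2, Finset.card_pair hwz]
    have h1Y : 1 ∉ Y := by
      rw [hYe]; simp only [Finset.mem_insert, Finset.mem_singleton]; omega
    have := hs Y hY 1 w le_rfl (by omega) hw.1 h1Y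
    obtain ⟨u, hu⟩ := hi _ this X hXF
    rw [hXe, hYe] at hu
    simp only [Finset.mem_inter, Finset.mem_insert, Finset.mem_singleton, Finset.mem_erase] at hu
    omega
  exact (Finset.card_le_card hsub).trans (by simp [Finset.card_powersetCard])

theorem shifted_bound : ∀ (n k : ℕ) (F : Finset (Finset ℕ)), 2 ≤ k → 2 * k ≤ n →
    F ⊆ Finset.powersetCard k (Finset.Icc 1 n) → IntF F → ShiftedF F →
    (n - 4).choose (k - 3) ≤ (F.filter (fun X => 1 ∉ X)).card →
    F.card ≤ 2 * (n - 3).choose (k - 2) + (n - 2).choose (k - 2) := by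
  intro n
  induction n with
  | zero => intro k F hk hn; omega
  | succ n ih =>
    intro k F hk hn hF hi hs hγ
    have hFc : ∀ X ∈ F, X ⊆ Finset.Icc 1 (n + 1) ∧ X.card = k :=
      fun X hX => Finset.mem_powersetCard.1 (hF hX)
    rcases hn.eq_or_lt with he | hlt
    · rw [← he]
      exact ekr_half k hk (Finset.Icc 1 (n + 1)) (by simp; omega) F hF hi
    rcases hk.eq_or_lt with he | hk3
    · subst he
      have := base_two (n + 1) F hF hi hs (by simpa using hγ)
      simpa using this
    set F0 := F.filter (fun X => n + 1 ∉ X) with hF0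
    set E := F.filter (fun X => n + 1 ∈ X) with hE
    set F1 := E.image (fun X => X.erase (n + 1)) with hF1
    have hEinj : Set.InjOn (fun X : Finset ℕ => X.erase (n + 1)) E := by
      intro X hX Y hY h
      rw [hE, Finset.mem_coe, Finset.mem_filter] at hX hY
      have := congrArg (insert (n + 1)) h
      simpa [Finset.insert_erase hX.2, Finset.insert_erase hY.2] using this
    have hF1c : F1.card = E.card := Finset.card_image_of_injOn hEinj
    have hsplit : E.card + F0.card = F.card := Finset.card_filter_add_card_filter_not (s := F) _
    have mem1 : ∀ X, X ∈ F1 ↔ (n + 1 ∉ X ∧ insert (n + 1) X ∈ F) := by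
      intro X
      rw [hF1, Finset.mem_image]
      constructor
      · rintro ⟨Z, hZ, rfl⟩
        rw [hE, Finset.mem_filter] at hZ
        rw [Finset.insert_erase hZ.2]
        exact ⟨Finset.notMem_erase _ _, hZ.1⟩
      · rintro ⟨h1, h2⟩
        exact ⟨_, Finset.mem_filter.2 ⟨h2, by simp⟩, Finset.erase_insert h1⟩
    have mem0 : ∀ X, X ∈ F0 ↔ (X ∈ F ∧ n + 1 ∉ X) := fun X => by rw [hF0, Finset.mem_filter]
    have hIcc : ∀ X, X ⊆ Finset.Icc 1 (n + 1) → n + 1 ∉ X → X ⊆ Finset.Icc 1 n := by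
      intro X h1 h2 x hx
      have h3 := h1 hx
      rw [Finset.mem_Icc] at h3 ⊢
      have : x ≠ n + 1 := fun h => h2 (h ▸ hx)
      omega
    have hF0s : F0 ⊆ Finset.powersetCard k (Finset.Icc 1 n) := by
      intro X hX
      rw [mem0] at hX
      exact Finset.mem_powersetCard.2 ⟨hIcc X (hFc X hX.1).1 hX.2, (hFc X hX.1).2⟩
    have hF1s : F1 ⊆ Finset.powersetCard (k - 1) (Finset.Icc 1 n) := by
      intro X hX
      rw [mem1] at hX
      have h1 := hFc _ hX.2
      rw [Finset.card_insert_of_notMem hX.1] at h1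
      exact Finset.mem_powersetCard.2
        ⟨hIcc X ((Finset.subset_insert _ _).trans h1.1) hX.1, by omega⟩
    have hF0i : IntF F0 := fun A hA B hB => hi A ((mem0 A).1 hA).1 B ((mem0 B).1 hB).1
    have hF1up : ∀ X ∈ F1, ∀ y, 1 ≤ y → y ≤ n → y ∉ X → insert y X ∈ F0 := by
      intro X hX y hy1 hyn hyX
      rw [mem1] at hX
      have := hs _ hX.2 y (n + 1) hy1 (by omega) (by simp)
        (by simp only [Finset.mem_insert, not_or]; exact ⟨by omega, hyX⟩)
      rw [Finset.erase_insert hX.1] at this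
      rw [mem0]
      refine ⟨this, ?_⟩
      simp only [Finset.mem_insert, not_or]
      exact ⟨by omega, hX.1⟩
    have hF1i : IntF F1 := by
      intro A hA B hB
      by_contra hcon
      rw [Finset.not_nonempty_iff_eq_empty] at hcon
      have hAc := Finset.mem_powersetCard.1 (hF1s hA)
      have hBc := Finset.mem_powersetCard.1 (hF1s hB)
      have hc : (A ∪ B).card < (Finset.Icc 1 n).card := by
        refine lt_of_le_of_lt (Finset.card_union_le A B) ?_
        simp only [Nat.card_Icc]
        omega
      obtain ⟨y, hy, hyAB⟩ := Finset.exists_mem_notMem_of_card_lt_card hc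
      rw [Finset.mem_Icc] at hy
      rw [Finset.mem_union, not_or] at hyAB
      have h1 := (mem0 _).1 (hF1up A hA y hy.1 hy.2 hyAB.1)
      obtain ⟨u, hu⟩ := hi _ h1.1 _ ((mem1 B).1 hB).2
      have hA1 := ((mem1 A).1 hA).1
      simp only [Finset.mem_inter, Finset.mem_insert] at hu
      rcases hu with ⟨rfl | hu, rfl | hu'⟩
      · omega
      · exact hyAB.2 hu'
      · exact hA1 hu
      · have : u ∈ A ∩ B := Finset.mem_inter.2 ⟨hu, hu'⟩
        rw [hcon] at this
        exact absurd this (Finset.notMem_empty _)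
    have hF0sh : ShiftedF F0 := by
      intro X hX i j h1 hij hj hiX
      have hjn := Finset.mem_Icc.1 ((Finset.mem_powersetCard.1 (hF0s hX)).1 hj)
      rw [mem0] at hX ⊢
      refine ⟨hs X hX.1 i j h1 hij hj hiX, ?_⟩
      simp only [Finset.mem_insert, Finset.mem_erase, not_or]
      exact ⟨by omega, fun h => hX.2 h.2⟩
    have hF1sh : ShiftedF F1 := by
      intro X hX i j h1 hij hj hiX
      have hjn := Finset.mem_Icc.1 ((Finset.mem_powersetCard.1 (hF1s hX)).1 hj)
      rw [mem1] at hX ⊢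
      have := hs _ hX.2 i j h1 hij (by simp [hj])
        (by simp only [Finset.mem_insert, not_or]; exact ⟨by omega, hiX⟩)
      rw [Finset.erase_insert_of_ne (by omega), Finset.insert_comm] at this
      refine ⟨?_, this⟩
      simp only [Finset.mem_insert, Finset.mem_erase, not_or]
      exact ⟨by omega, fun h => hX.1 h.2⟩
    set W := Finset.Icc 2 n with hW
    have hWc : W.card = n - 1 := by simp [hW]
    set G0 := F0.filter (fun X => 1 ∉ X) with hG0
    set G1 := F1.filter (fun X => 1 ∉ X) with hG1
    have hcard : G0.card + G1.card = (F.filter (fun X => 1 ∉ X)).card := by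
      have e1 : G1.card = ((F.filter (fun X => 1 ∉ X)).filter (fun X => n + 1 ∈ X)).card := by
        have : G1 = ((F.filter (fun X => 1 ∉ X)).filter (fun X => n + 1 ∈ X)).image
            (fun X => X.erase (n + 1)) := by
          ext X
          rw [hG1, Finset.mem_filter, hF1, hE]
          simp only [Finset.mem_image, Finset.mem_filter]
          constructor
          · rintro ⟨⟨Z, hZ, rfl⟩, h⟩
            refine ⟨Z, ⟨⟨hZ.1, fun h1 => h ?_⟩, hZ.2⟩, rfl⟩
            exact Finset.mem_erase.2 ⟨by omega, h1⟩
          · rintro ⟨Z, hZ, rfl⟩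
            exact ⟨⟨Z, ⟨hZ.1.1, hZ.2⟩, rfl⟩, fun h => hZ.1.2 (Finset.mem_of_mem_erase h)⟩
        rw [this]
        apply Finset.card_image_of_injOn
        apply hEinj.mono
        intro X hX
        rw [Finset.mem_coe, Finset.mem_filter, Finset.mem_filter] at hX
        rw [hE, Finset.mem_coe, Finset.mem_filter]
        exact ⟨hX.1.1, hX.2⟩
      have e0 : G0 = (F.filter (fun X => 1 ∉ X)).filter (fun X => n + 1 ∉ X) := by
        rw [hG0, hF0, Finset.filter_comm]
      rw [e1, e0, add_comm]
      exact Finset.card_filter_add_card_filter_not _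
    have hIccW : ∀ X, X ⊆ Finset.Icc 1 n → 1 ∉ X → X ⊆ W := by
      intro X h1 h2 x hx
      have h3 := h1 hx
      rw [hW]
      rw [Finset.mem_Icc] at h3 ⊢
      have : x ≠ 1 := fun h => h2 (h ▸ hx)
      omega
    have hG0s : G0 ⊆ Finset.powersetCard k W := by
      intro X hX
      rw [hG0, Finset.mem_filter] at hX
      have := Finset.mem_powersetCard.1 (hF0s hX.1)
      exact Finset.mem_powersetCard.2 ⟨hIccW X this.1 hX.2, this.2⟩
    have hG1s : G1 ⊆ Finset.powersetCard (k - 1) W := by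
      intro X hX
      rw [hG1, Finset.mem_filter] at hX
      have := Finset.mem_powersetCard.1 (hF1s hX.1)
      exact Finset.mem_powersetCard.2 ⟨hIccW X this.1 hX.2, this.2⟩
    have hup : (shq (n - 1 - k) (coV W G1)).card ≤ G0.card := by
      apply Finset.card_le_card_of_injOn (fun Y => W \ Y)
      · intro Y hY
        obtain ⟨X, hX, hYW, hYX, hYc⟩ := mem_shq_coV.1 hY
        have hXc := Finset.mem_powersetCard.1 (hG1s hX)
        have hXs : X ⊆ W \ Y := Finset.subset_sdiff.2 ⟨hXc.1, hYX.symm⟩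
        have hcc : ((W \ Y) \ X).card = 1 := by
          rw [Finset.card_sdiff_of_subset hXs, Finset.card_sdiff_of_subset hYW, hWc, hYc, hXc.2]
          omega
        obtain ⟨y, hy⟩ := Finset.card_eq_one.1 hcc
        have hym : y ∈ (W \ Y) \ X := by rw [hy]; simp
        rw [Finset.mem_sdiff, Finset.mem_sdiff, hW, Finset.mem_Icc] at hym
        have hWY : W \ Y = insert y X := by
          rw [← Finset.union_sdiff_of_subset hXs, hy, Finset.union_comm]; rfl
        rw [hG1, Finset.mem_filter] at hX
        simp only [Finset.mem_coe]
        rw [hWY, hG0, Finset.mem_filter]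
        refine ⟨hF1up X hX.1 y (by omega) (by omega) hym.2, ?_⟩
        simp only [Finset.mem_insert, not_or]
        exact ⟨by omega, hX.2⟩
      · intro Y hY Y' hY' h
        obtain ⟨X, hX, hYW, hYX, hYc⟩ := mem_shq_coV.1 hY
        obtain ⟨X', hX', hYW', hYX', hYc'⟩ := mem_shq_coV.1 hY'
        have := congrArg (fun Z => W \ Z) h
        simpa [Finset.sdiff_sdiff_eq_self hYW, Finset.sdiff_sdiff_eq_self hYW'] using this
    have hco1c := coV_card W G1 (fun X hX => (Finset.mem_powersetCard.1 (hG1s hX)).1)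
    have hco1s := coV_sized hG1s
    have hco0c := coV_card W G0 (fun X hX => (Finset.mem_powersetCard.1 (hG0s hX)).1)
    have hco0s := coV_sized hG0s
    rw [hWc] at hco1s hco0s
    obtain ⟨N, rfl⟩ : ∃ N, n = N + 4 := ⟨n - 4, by omega⟩
    obtain ⟨j, rfl⟩ : ∃ j, k = j + 3 := ⟨k - 3, by omega⟩
    rw [show N + 4 + 1 - 4 = N + 1 by omega, show j + 3 - 3 = j by omega] at hγ
    have hG0ge : N.choose j ≤ G0.card := by
      by_contra hcon
      push Not at hcon
      rcases Nat.eq_zero_or_pos j with rfl | hj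
      · rw [Nat.choose_zero_right] at hγ hcon
        have h1 : 1 ≤ G1.card := by omega
        have := LKL (coV W G1) (N + 4 - 1 - (0 + 3 - 1)) (N + 4 - 1 - (0 + 3)) (N + 1) (by omega)
          (by omega) hco1s (by rw [hco1c, show N + 4 - 1 - (0 + 3 - 1) = N + 1 by omega, Nat.choose_self]; exact h1)
        have h2 : 0 < (N + 1).choose (N + 4 - 1 - (0 + 3)) := Nat.choose_pos (by omega)
        omega
      · obtain ⟨i, rfl⟩ : ∃ i, j = i + 1 := ⟨j - 1, by omega⟩
        have hp := Nat.choose_succ_succ N i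
        simp only [Nat.succ_eq_add_one] at hp
        have e1 : N.choose (N + 4 - 1 - (i + 1 + 3 - 1)) = N.choose i := by
          rw [← Nat.choose_symm (by omega)]; congr 1; omega
        have e2 : N.choose (N + 4 - 1 - (i + 1 + 3)) = N.choose (i + 1) := by
          rw [← Nat.choose_symm (by omega)]; congr 1; omega
        have := LKL (coV W G1) (N + 4 - 1 - (i + 1 + 3 - 1)) (N + 4 - 1 - (i + 1 + 3)) N (by omega)
          (by omega) hco1s (by rw [hco1c, e1]; omega)
        omega
    have ih0 := ih (j + 3) F0 (by omega) (by omega) hF0s hF0i hF0sh (by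
      rw [show N + 4 - 4 = N by omega, show j + 3 - 3 = j by omega]; exact hG0ge)
    have hF1bound : F1.card ≤ 2 * (N + 1).choose j + (N + 2).choose j := by
      by_cases hc : N.choose (j - 1) ≤ G1.card
      · have ih1 := ih (j + 3 - 1) F1 (by omega) (by omega) hF1s hF1i hF1sh (by
          rw [show N + 4 - 4 = N by omega, show j + 3 - 1 - 3 = j - 1 by omega]; exact hc)
        rw [show N + 4 - 3 = N + 1 by omega, show N + 4 - 2 = N + 2 by omega,
          show j + 3 - 1 - 2 = j by omega] at ih1
        exact ih1
      · push Not at hc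
        set A := (F1.filter (fun X => 1 ∈ X)).image (fun X => X.erase 1) with hA
        have hAc : A.card = (F1.filter (fun X => 1 ∈ X)).card := by
          apply Finset.card_image_of_injOn
          intro X hX Y hY h
          rw [Finset.mem_coe, Finset.mem_filter] at hX hY
          have := congrArg (insert 1) h
          simpa [Finset.insert_erase hX.2, Finset.insert_erase hY.2] using this
        have hsp : (F1.filter (fun X => 1 ∈ X)).card + G1.card = F1.card :=
          Finset.card_filter_add_card_filter_not _
        have hAs : A ⊆ Finset.powersetCard (j + 1) W := by
          intro Y hY
          rw [hA, Finset.mem_image] at hY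
          obtain ⟨X, hX, rfl⟩ := hY
          rw [Finset.mem_filter] at hX
          have := Finset.mem_powersetCard.1 (hF1s hX.1)
          rw [Finset.mem_powersetCard, Finset.card_erase_of_mem hX.2]
          exact ⟨hIccW _ ((Finset.erase_subset _ _).trans this.1) (Finset.notMem_erase _ _),
            by omega⟩
        have hcr := cross_bound W A G0 (j + 1) hAs (by
          intro Y hY X hX
          rw [hA, Finset.mem_image] at hY
          obtain ⟨Z, hZ, rfl⟩ := hY
          rw [Finset.mem_filter, mem1] at hZ
          rw [hG0, Finset.mem_filter, mem0] at hX
          obtain ⟨u, hu⟩ := hi _ hZ.1.2 X hX.1.1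
          rw [Finset.mem_inter, Finset.mem_insert] at hu
          refine ⟨u, Finset.mem_inter.2 ⟨Finset.mem_erase.2 ⟨?_, ?_⟩, hu.2⟩⟩
          · rintro rfl; exact hX.2 hu.2
          · rcases hu.1 with rfl | h
            · exact absurd hu.2 hX.1.2
            · exact h)
        have e1 : N.choose (N + 4 - 1 - (j + 3)) = N.choose j := by
          rw [← Nat.choose_symm (by omega)]; congr 1; omega
        have hD := LKL (coV W G0) (N + 4 - 1 - (j + 3)) (j + 1) N (by omega) (by omega) hco0s
          (by rw [hco0c, e1]; exact hG0ge)
        rw [hWc, show N + 4 - 1 = N + 3 by omega] at hcr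
        have p1 := Nat.choose_succ_succ (N + 2) j
        have p2 := Nat.choose_succ_succ (N + 1) j
        have p3 := Nat.choose_succ_succ N j
        simp only [Nat.succ_eq_add_one, add_assoc, Nat.reduceAdd] at p1 p2 p3
        have p4 : N.choose j + N.choose (j - 1) ≤ (N + 1).choose j + 1 := by
          rcases Nat.eq_zero_or_pos j with rfl | hj
          · simp
          · obtain ⟨i, rfl⟩ : ∃ i, j = i + 1 := ⟨j - 1, by omega⟩
            have hp := Nat.choose_succ_succ N i
            simp only [Nat.succ_eq_add_one] at hp
            rw [show i + 1 - 1 = i by omega]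
            omega
        omega
    rw [show N + 4 - 3 = N + 1 by omega, show N + 4 - 2 = N + 2 by omega,
      show j + 3 - 2 = j + 1 by omega] at ih0
    rw [show N + 4 + 1 - 3 = N + 2 by omega, show N + 4 + 1 - 2 = N + 3 by omega,
      show j + 3 - 2 = j + 1 by omega]
    have p1 := Nat.choose_succ_succ (N + 2) j
    have p2 := Nat.choose_succ_succ (N + 1) j
    simp only [Nat.succ_eq_add_one, add_assoc, Nat.reduceAdd] at p1 p2
    omega


theorem rho_arith (w k : ℕ) (hk : 5 ≤ k) (hw : 2 * k - 1 ≤ w) :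
    (w - 2).choose (k - 1) * (w + 1 - k) ≤ (w + 1 - k).choose (k - 2) * (w - 2).choose (k - 3) := by
  obtain ⟨j, rfl⟩ : ∃ j, k = j + 3 := ⟨k - 3, by omega⟩
  obtain ⟨m, rfl⟩ : ∃ m, w = m + j + 3 := ⟨w - j - 3, by omega⟩
  rw [show m + j + 3 - 2 = m + j + 1 by omega, show j + 3 - 1 = j + 2 by omega,
    show m + j + 3 + 1 - (j + 3) = m + 1 by omega, show j + 3 - 2 = j + 1 by omega,
    show j + 3 - 3 = j by omega]
  have a1 := Nat.choose_succ_right_eq (m + j + 1) j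
  have a2 := Nat.choose_succ_right_eq (m + j + 1) (j + 1)
  have a3 := Nat.add_one_mul_choose_eq m j
  have a4 : m.choose 2 ≤ m.choose j := choose_two_le m j (by omega) (by omega)
  rw [show m + j + 1 - j = m + 1 by omega] at a1
  rw [show m + j + 1 - (j + 1) = m by omega, show j + 1 + 1 = j + 2 by ring] at a2
  have a5 : m * (m - 1) ≤ 2 * m.choose 2 := by
    rw [Nat.choose_two_right]
    have := Nat.div_mul_cancel (Nat.even_mul_pred_self m).two_dvd
    omega
  obtain ⟨l, rfl⟩ : ∃ l, m = l + 1 := ⟨m - 1, by omega⟩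
  rw [show l + 1 - 1 = l by omega] at a5
  have a6 : (l + 1 + 1) * (l + 1) ≤ (j + 2) * (l + 1).choose j := by
    have hl : 2 ≤ l := by omega
    have hj4 : 4 ≤ j + 2 := by omega
    have h1 := Nat.mul_le_mul_right ((l + 1).choose j) hj4
    have h2 := Nat.mul_le_mul_right (l + 1) (show l + 1 + 1 ≤ 2 * l by omega)
    nlinarith
  set G := (l + 1 + j + 1).choose j
  set M := (l + 1 + j + 1).choose (j + 2)
  set M1 := (l + 1 + j + 1).choose (j + 1)
  set Q := (l + 1 + 1).choose (j + 1)
  set R := (l + 1).choose j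
  refine Nat.le_of_mul_le_mul_right ?_ (by positivity : 0 < (j + 1) * (j + 2))
  calc M * (l + 1 + 1) * ((j + 1) * (j + 2)) = (M * (j + 2)) * (j + 1) * (l + 1 + 1) := by ring
    _ = (M1 * (j + 1)) * (l + 1) * (l + 1 + 1) := by rw [a2]; ring
    _ = G * (l + 1 + 1) * ((l + 1 + 1) * (l + 1)) := by rw [a1]; ring
    _ ≤ G * (l + 1 + 1) * ((j + 2) * R) := Nat.mul_le_mul_left _ a6
    _ = ((l + 1 + 1) * R) * G * (j + 2) := by ring
    _ = Q * G * ((j + 1) * (j + 2)) := by rw [a3]; ring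

theorem g_bound (W : Finset ℕ) (k : ℕ) (a b c d : Finset (Finset ℕ)) (hk : 5 ≤ k)
    (hw : 2 * k - 1 ≤ W.card) (ha : a ⊆ Finset.powersetCard (k - 1) W)
    (hb : b ⊆ Finset.powersetCard (k - 1) W) (hc : c ⊆ Finset.powersetCard k W)
    (hd : d ⊆ Finset.powersetCard (k - 2) W)
    (hab : ∀ Y ∈ a, ∀ X ∈ b, (Y ∩ X).Nonempty) (hdc : ∀ Y ∈ d, ∀ X ∈ c, (Y ∩ X).Nonempty)
    (hle : b.card ≤ a.card) (hbc : (W.card - 2).choose (k - 3) ≤ b.card + c.card)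
    (hcn : c.card ≤ W.card + 1 - k) :
    a.card + b.card + c.card + d.card
      ≤ 2 * (W.card - 1).choose (k - 2) + W.card.choose (k - 2) := by
  have hcb1 := cross_bound W a b (k - 1) ha hab
  have hcb2 := cross_bound W d c (k - 2) hd hdc
  have hbs := coV_sized hb
  have hcs := coV_sized hc
  have hbcard := coV_card W b (fun X hX => (Finset.mem_powersetCard.1 (hb hX)).1)
  have hccard := coV_card W c (fun X hX => (Finset.mem_powersetCard.1 (hc hX)).1)
  set w := W.card with hwdef
  rw [show w - (k - 1) = w + 1 - k by omega] at hbs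
  set Db := (shq (k - 1) (coV W b)).card
  set Dc := (shq (k - 2) (coV W c)).card
  have f1 : (w - 2).choose (w + 1 - k) = (w - 2).choose (k - 3) := by
    rw [← Nat.choose_symm (by omega)]; congr 1; omega
  have f2 : (w - 1).choose (w + 1 - k) = (w - 1).choose (k - 2) := by
    rw [← Nat.choose_symm (by omega)]; congr 1; omega
  obtain ⟨y, hy⟩ : ∃ y, w = y + 2 := ⟨w - 2, by omega⟩
  obtain ⟨j, hj⟩ : ∃ j, k = j + 3 := ⟨k - 3, by omega⟩
  have pas : w.choose (k - 1) + (w - 2).choose (k - 3)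
      = 2 * (w - 1).choose (k - 2) + (w - 2).choose (k - 1) := by
    rw [hy, hj, show y + 2 - 2 = y by omega, show y + 2 - 1 = y + 1 by omega,
      show j + 3 - 1 = j + 2 by omega, show j + 3 - 2 = j + 1 by omega,
      show j + 3 - 3 = j by omega]
    have p1 := Nat.choose_succ_succ (y + 1) (j + 1)
    have p2 := Nat.choose_succ_succ y (j + 1)
    have p3 := Nat.choose_succ_succ y j
    simp only [Nat.succ_eq_add_one, add_assoc, Nat.reduceAdd] at p1 p2 p3
    omega
  by_cases hbG : (w - 2).choose (k - 3) ≤ b.card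
  · have hb2 : b.card ≤ (w - 2 + 1).choose (w + 1 - k) := by
      rw [show w - 2 + 1 = w - 1 by omega]
      by_contra hcon
      push Not at hcon
      have := LKL (coV W b) (w + 1 - k) (k - 1) (w - 1) (by omega) (by omega) hbs
        (by rw [hbcard]; exact hcon.le)
      have p1 := Nat.choose_succ_succ (y + 1) (j + 1)
      simp only [Nat.succ_eq_add_one, add_assoc, Nat.reduceAdd] at p1
      rw [f2] at hcon
      rw [hy, hj, show y + 2 - 1 = y + 1 by omega, show j + 3 - 2 = j + 1 by omega] at hcon
      have hthis : (y + 1).choose (j + 2) ≤ Db := by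
        rw [hy, hj, show y + 2 - 1 = y + 1 by omega, show j + 3 - 1 = j + 2 by omega] at this
        convert this using 3
        omega
      rw [hy, hj, show j + 3 - 1 = j + 2 by omega] at hcb1
      have hcb1' : a.card + Db ≤ (y + 2).choose (j + 2) := by
        convert hcb1 using 3
      omega
    have h2 := LK2 (coV W b) (w + 1 - k) (k - 1) (w - 2) (by omega) (by omega) (by omega)
      (by omega) hbs (by rw [hbcard, f1]; exact hbG) (by rw [hbcard]; exact hb2)
    rw [hbcard, f1] at h2
    have h3 := LK_bal (coV W c) (w - k) (k - 2) (by omega) hcs (by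
      rw [hccard, show k - 2 + (w - k) = w - 2 by omega]
      have e1 : (w - 2).choose 1 ≤ (w - 2).choose (k - 2) := choose_mono_right (by omega) (by omega)
      rw [← Nat.choose_symm (by omega : k - 2 ≤ w - 2), Nat.choose_one_right,
        show w - 2 - (k - 2) = w - k by omega] at e1
      omega)
    rw [hccard] at h3
    omega
  · push Not at hbG
    set Γ := (w - 2).choose (k - 3) with hΓ
    set M := (w - 2).choose (k - 1) with hM
    have hMΓ : Γ ≤ M := choose_mono_right (by omega) (by omega)
    have g1 := LK (coV W b) (w + 1 - k) (k - 1) (w - 2) (by omega) hbs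
      (by rw [hbcard, f1]; exact hbG.le)
    rw [hbcard, f1] at g1
    have e1 : (w + 1 - k).choose (w - k) = w + 1 - k := by
      rw [show w + 1 - k = w - k + 1 by omega, Nat.choose_succ_self_right]
    have g2 := LK (coV W c) (w - k) (k - 2) (w + 1 - k) (by omega) hcs
      (by rw [hccard, e1]; exact hcn)
    rw [hccard, e1] at g2
    have g3 := rho_arith w k hk hw
    change M * (w + 1 - k) ≤ (w + 1 - k).choose (k - 2) * Γ at g3
    change b.card * M ≤ Db * Γ at g1
    change c.card * (w + 1 - k).choose (k - 2) ≤ Dc * (w + 1 - k) at g2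
    have g4 : c.card * M ≤ Dc * Γ := by
      refine Nat.le_of_mul_le_mul_right ?_ (by omega : 0 < w + 1 - k)
      calc c.card * M * (w + 1 - k) = c.card * (M * (w + 1 - k)) := by ring
        _ ≤ c.card * ((w + 1 - k).choose (k - 2) * Γ) := Nat.mul_le_mul_left _ g3
        _ = (c.card * (w + 1 - k).choose (k - 2)) * Γ := by ring
        _ ≤ (Dc * (w + 1 - k)) * Γ := Nat.mul_le_mul_right _ g2
        _ = _ := by ring
    have hΓ0 : 0 < Γ := Nat.choose_pos (by omega)
    obtain ⟨δ, hδ⟩ := Nat.exists_eq_add_of_le hMΓ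
    obtain ⟨ε, hε⟩ := Nat.exists_eq_add_of_le hbc
    have g5 : b.card + c.card + δ ≤ Db + Dc := by
      refine Nat.le_of_mul_le_mul_right ?_ hΓ0
      have : (b.card + c.card) * M ≤ (Db + Dc) * Γ := by rw [add_mul, add_mul]; omega
      refine le_trans ?_ this
      rw [hε, hδ]
      nlinarith [Nat.zero_le (ε * δ)]
    omega


def tauS (F : Finset (Finset ℕ)) (i j : ℕ) (X : Finset ℕ) : Finset ℕ :=
  if j ∈ X ∧ i ∉ X ∧ insert i (X.erase j) ∉ F then insert i (X.erase j) else X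

theorem tau_inj (F : Finset (Finset ℕ)) (i j : ℕ) (hij : i ≠ j) :
    Set.InjOn (tauS F i j) F := by
  intro X hX Y hY h
  have hX' : X ∈ F := hX
  have hY' : Y ∈ F := hY
  unfold tauS at h
  split_ifs at h with h1 h2 h2
  · obtain ⟨a1, a2, a3⟩ := h1
    obtain ⟨b1, b2, b3⟩ := h2
    ext z
    have := congrArg (fun T => z ∈ T) h
    simp only [Finset.mem_insert, Finset.mem_erase, eq_iff_iff] at this
    by_cases hz : z = i
    · subst hz; tauto
    · by_cases hz2 : z = j
      · subst hz2; tauto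
      · tauto
  · exact absurd (h ▸ hY') h1.2.2
  · exact absurd (h.symm ▸ hX') h2.2.2
  · exact h

theorem tau_int_aux (F : Finset (Finset ℕ)) (i j : ℕ) (hF : IntF F)
    (X Y : Finset ℕ) (hX : X ∈ F) (hY : Y ∈ F)
    (h1 : j ∈ X ∧ i ∉ X ∧ insert i (X.erase j) ∉ F)
    (h2 : ¬ (j ∈ Y ∧ i ∉ Y ∧ insert i (Y.erase j) ∉ F)) :
    (insert i (X.erase j) ∩ Y).Nonempty := by
  by_cases hiY : i ∈ Y
  · exact ⟨i, by simp [hiY]⟩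
  by_cases hjY : j ∈ Y
  · have hY2 : insert i (Y.erase j) ∈ F := by
      by_contra h; exact h2 ⟨hjY, hiY, h⟩
    obtain ⟨z, hz⟩ := hF X hX _ hY2
    simp only [Finset.mem_inter, Finset.mem_insert, Finset.mem_erase] at hz
    refine ⟨z, ?_⟩
    simp only [Finset.mem_inter, Finset.mem_insert, Finset.mem_erase]
    rcases hz with ⟨a, rfl | b⟩
    · exact absurd a h1.2.1
    · tauto
  · obtain ⟨z, hz⟩ := hF X hX _ hY
    simp only [Finset.mem_inter] at hz
    refine ⟨z, ?_⟩
    simp only [Finset.mem_inter, Finset.mem_insert, Finset.mem_erase]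
    have : z ≠ j := by rintro rfl; exact hjY hz.2
    tauto

theorem tau_int (F : Finset (Finset ℕ)) (i j : ℕ) (hF : IntF F) :
    IntF (F.image (tauS F i j)) := by
  intro A hA B hB
  obtain ⟨X, hX, rfl⟩ := Finset.mem_image.1 hA
  obtain ⟨Y, hY, rfl⟩ := Finset.mem_image.1 hB
  unfold tauS
  split_ifs with h1 h2 h2
  · exact ⟨i, by simp⟩
  · exact tau_int_aux F i j hF X Y hX hY h1 h2
  · rw [Finset.inter_comm]; exact tau_int_aux F i j hF Y X hY hX h2 h1
  · exact hF X hX Y hY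

theorem tau_sub (n k : ℕ) (F : Finset (Finset ℕ)) (i j : ℕ) (hi : i ∈ Finset.Icc 1 n)
    (hF : F ⊆ Finset.powersetCard k (Finset.Icc 1 n)) :
    F.image (tauS F i j) ⊆ Finset.powersetCard k (Finset.Icc 1 n) := by
  intro A hA
  obtain ⟨X, hX, rfl⟩ := Finset.mem_image.1 hA
  have hX2 := Finset.mem_powersetCard.1 (hF hX)
  unfold tauS
  split_ifs with h1
  · rw [Finset.mem_powersetCard]
    constructor
    · exact Finset.insert_subset hi ((Finset.erase_subset _ _).trans hX2.1)
    · rw [Finset.card_insert_of_notMem (by simp [h1.2.1]), Finset.card_erase_of_mem h1.1]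
      have := Finset.card_pos.2 ⟨j, h1.1⟩
      omega
  · exact hF hX

theorem tau_weight_le (F : Finset (Finset ℕ)) (i j : ℕ) (hij : i < j) (X : Finset ℕ) :
    ∑ x ∈ tauS F i j X, x ≤ ∑ x ∈ X, x := by
  unfold tauS
  split_ifs with h1
  · rw [Finset.sum_insert (by simp [h1.2.1])]
    have := Finset.add_sum_erase X (fun x => x) h1.1
    omega
  · exact le_rfl

theorem tau_weight (F : Finset (Finset ℕ)) (i j : ℕ) (hij : i < j) (X : Finset ℕ)
    (hX : X ∈ F) (h1 : j ∈ X) (h2 : i ∉ X) (h3 : insert i (X.erase j) ∉ F) :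
    ∑ X ∈ F.image (tauS F i j), ∑ x ∈ X, x < ∑ X ∈ F, ∑ x ∈ X, x := by
  rw [Finset.sum_image (tau_inj F i j hij.ne)]
  refine Finset.sum_lt_sum (fun X _ => tau_weight_le F i j hij X) ⟨X, hX, ?_⟩
  unfold tauS
  rw [if_pos ⟨h1, h2, h3⟩, Finset.sum_insert (by simp [h2])]
  have := Finset.add_sum_erase X (fun x => x) h1
  omega

theorem erase_card (F : Finset (Finset ℕ)) (x : ℕ) (h : ∀ X ∈ F, x ∈ X) :
    (F.image (fun X => X.erase x)).card = F.card := by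
  apply Finset.card_image_of_injOn
  intro X hX Y hY hXY
  have hx1 := h X hX
  have hx2 := h Y hY
  have : insert x (X.erase x) = insert x (Y.erase x) := by
    simp only at hXY; rw [hXY]
  rwa [Finset.insert_erase hx1, Finset.insert_erase hx2] at this

theorem regime1F (n k : ℕ) (F : Finset (Finset ℕ)) (x : ℕ) (hk : 5 ≤ k) (hn : 2 * k < n)
    (hF : F ⊆ Finset.powersetCard k (Finset.Icc 1 n)) (hI : IntF F) (hx : x ∈ Finset.Icc 1 n)
    (hg : (F.filter (fun X => x ∉ X)).card < (n - 4).choose (k - 3)) :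
    (∃ K ⊆ (Finset.Icc 1 n).erase x, K.card = k - 1 ∧ ∀ X ∈ F, x ∉ X → K ⊆ X) ∨
    (∃ B1 B2, B1 ≠ B2 ∧ F.filter (fun X => x ∉ X) = {B1, B2} ∧ (B1 ∩ B2).card + 2 ≤ k) ∨
    F.card + 2 * (n - 1 - k).choose (k - 1)
      < (n - 1).choose (k - 1) + (n - 1 - k - 2).choose (k - 1) + 2 := by
  have hV : ((Finset.Icc 1 n).erase x).card = n - 1 := by
    rw [Finset.card_erase_of_mem hx]; simp
  have hA : ∀ Y ∈ (F.filter (fun X => x ∈ X)).image (fun X => X.erase x),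
      ∃ X ∈ F, x ∈ X ∧ X.erase x = Y := by
    intro Y hY
    obtain ⟨X, hX, rfl⟩ := Finset.mem_image.1 hY
    exact ⟨X, (Finset.mem_filter.1 hX).1, (Finset.mem_filter.1 hX).2, rfl⟩
  have hAc : ((F.filter (fun X => x ∈ X)).image (fun X => X.erase x)).card
      = (F.filter (fun X => x ∈ X)).card :=
    erase_card _ x (fun X hX => (Finset.mem_filter.1 hX).2)
  have hsum := Finset.card_filter_add_card_filter_not (s := F) (fun X => x ∈ X)
  have := regime1 ((Finset.Icc 1 n).erase x) k
    ((F.filter (fun X => x ∈ X)).image (fun X => X.erase x)) (F.filter (fun X => x ∉ X)) hk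
    (by rw [hV]; omega) (by
      intro Y hY
      obtain ⟨X, hX, hxX, rfl⟩ := hA Y hY
      have h2 := Finset.mem_powersetCard.1 (hF hX)
      rw [Finset.mem_powersetCard, Finset.card_erase_of_mem hxX, h2.2]
      exact ⟨Finset.erase_subset_erase _ h2.1, rfl⟩) (by
      intro X hX
      obtain ⟨hX, hxX⟩ := Finset.mem_filter.1 hX
      have h2 := Finset.mem_powersetCard.1 (hF hX)
      rw [Finset.mem_powersetCard]
      exact ⟨Finset.subset_erase.2 ⟨h2.1, hxX⟩, h2.2⟩) (by
      intro Y hY X hX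
      obtain ⟨Z, hZ, hxZ, rfl⟩ := hA Y hY
      obtain ⟨hX, hxX⟩ := Finset.mem_filter.1 hX
      obtain ⟨z, hz⟩ := hI Z hZ X hX
      rw [Finset.mem_inter] at hz
      refine ⟨z, ?_⟩
      rw [Finset.mem_inter, Finset.mem_erase]
      exact ⟨⟨by rintro rfl; exact hxX hz.2, hz.1⟩, hz.2⟩) (by
      rw [hV, show n - 1 - 3 = n - 4 by omega]; exact hg)
  rw [hV, hAc] at this
  rcases this with ⟨K, h1, h2, h3⟩ | h | h
  · left
    exact ⟨K, h1, h2, fun X hX hxX => h3 X (Finset.mem_filter.2 ⟨hX, hxX⟩)⟩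
  · right; left; exact h
  · right; right
    omega

theorem four_bound_aux (n k : ℕ) (F : Finset (Finset ℕ)) (i j : ℕ) (hk : 5 ≤ k) (hn : 2 * k < n)
    (hF : F ⊆ Finset.powersetCard k (Finset.Icc 1 n)) (hI : IntF F)
    (hi : i ∈ Finset.Icc 1 n) (hj : j ∈ Finset.Icc 1 n) (hij : i ≠ j)
    (hc : (F.filter (fun X => i ∉ X ∧ j ∉ X)).card ≤ n - k - 1)
    (hgi : (n - 4).choose (k - 3) ≤ (F.filter (fun X => i ∉ X)).card)
    (hle : (F.filter (fun X => i ∉ X ∧ j ∈ X)).card ≤ (F.filter (fun X => i ∈ X ∧ j ∉ X)).card) :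
    F.card ≤ 2 * (n - 3).choose (k - 2) + (n - 2).choose (k - 2) := by
  set W := ((Finset.Icc 1 n).erase i).erase j with hWd
  have hW : W.card = n - 2 := by
    rw [hWd, Finset.card_erase_of_mem (Finset.mem_erase.2 ⟨hij.symm, hj⟩),
      Finset.card_erase_of_mem hi]
    simp; omega
  have hmW : ∀ z, z ∈ W ↔ z ≠ i ∧ z ≠ j ∧ z ∈ Finset.Icc 1 n := by
    intro z; rw [hWd, Finset.mem_erase, Finset.mem_erase]; tauto
  set a := (F.filter (fun X => i ∈ X ∧ j ∉ X)).image (fun X => X.erase i) with had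
  set b := (F.filter (fun X => i ∉ X ∧ j ∈ X)).image (fun X => X.erase j) with hbd
  set c := F.filter (fun X => i ∉ X ∧ j ∉ X) with hcd
  set d' := (F.filter (fun X => i ∈ X ∧ j ∈ X)).image (fun X => X.erase i) with hdd'
  set d := d'.image (fun X => X.erase j) with hdd
  have hac : a.card = (F.filter (fun X => i ∈ X ∧ j ∉ X)).card :=
    erase_card _ i (fun X hX => (Finset.mem_filter.1 hX).2.1)
  have hbc : b.card = (F.filter (fun X => i ∉ X ∧ j ∈ X)).card :=
    erase_card _ j (fun X hX => (Finset.mem_filter.1 hX).2.2)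
  have hdc : d.card = (F.filter (fun X => i ∈ X ∧ j ∈ X)).card := by
    rw [hdd, erase_card, hdd', erase_card]
    · exact fun X hX => (Finset.mem_filter.1 hX).2.1
    · intro X hX
      obtain ⟨Z, hZ, rfl⟩ := Finset.mem_image.1 hX
      exact Finset.mem_erase.2 ⟨hij.symm, (Finset.mem_filter.1 hZ).2.2⟩
  have ma : ∀ Y ∈ a, ∃ X ∈ F, i ∈ X ∧ j ∉ X ∧ X.erase i = Y := by
    intro Y hY
    obtain ⟨X, hX, rfl⟩ := Finset.mem_image.1 hY
    obtain ⟨h1, h2, h3⟩ := Finset.mem_filter.1 hX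
    exact ⟨X, h1, h2, h3, rfl⟩
  have mb : ∀ Y ∈ b, ∃ X ∈ F, i ∉ X ∧ j ∈ X ∧ X.erase j = Y := by
    intro Y hY
    obtain ⟨X, hX, rfl⟩ := Finset.mem_image.1 hY
    obtain ⟨h1, h2, h3⟩ := Finset.mem_filter.1 hX
    exact ⟨X, h1, h2, h3, rfl⟩
  have md : ∀ Y ∈ d, ∃ X ∈ F, i ∈ X ∧ j ∈ X ∧ (X.erase i).erase j = Y := by
    intro Y hY
    obtain ⟨Z, hZ, rfl⟩ := Finset.mem_image.1 hY
    obtain ⟨X, hX, rfl⟩ := Finset.mem_image.1 hZ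
    obtain ⟨h1, h2, h3⟩ := Finset.mem_filter.1 hX
    exact ⟨X, h1, h2, h3, rfl⟩
  have s1 : (F.filter (fun X => i ∈ X)).card = (F.filter (fun X => i ∈ X ∧ j ∈ X)).card
      + (F.filter (fun X => i ∈ X ∧ j ∉ X)).card := by
    have := Finset.card_filter_add_card_filter_not (s := F.filter (fun X => i ∈ X)) (fun X => j ∈ X)
    rw [Finset.filter_filter, Finset.filter_filter] at this
    exact this.symm
  have s2 : (F.filter (fun X => i ∉ X)).card = (F.filter (fun X => i ∉ X ∧ j ∈ X)).card
      + c.card := by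
    have := Finset.card_filter_add_card_filter_not (s := F.filter (fun X => i ∉ X)) (fun X => j ∈ X)
    rw [Finset.filter_filter, Finset.filter_filter] at this
    exact this.symm
  have s3 := Finset.card_filter_add_card_filter_not (s := F) (fun X => i ∈ X)
  have key := g_bound W k a b c d hk (by omega) (by
      intro Y hY
      obtain ⟨X, hX, h1, h2, rfl⟩ := ma Y hY
      have h3 := Finset.mem_powersetCard.1 (hF hX)
      rw [Finset.mem_powersetCard, Finset.card_erase_of_mem h1, h3.2]
      refine ⟨fun z hz => ?_, rfl⟩
      rw [Finset.mem_erase] at hz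
      exact (hmW z).2 ⟨hz.1, by rintro rfl; exact h2 hz.2, h3.1 hz.2⟩) (by
      intro Y hY
      obtain ⟨X, hX, h1, h2, rfl⟩ := mb Y hY
      have h3 := Finset.mem_powersetCard.1 (hF hX)
      rw [Finset.mem_powersetCard, Finset.card_erase_of_mem h2, h3.2]
      refine ⟨fun z hz => ?_, rfl⟩
      rw [Finset.mem_erase] at hz
      exact (hmW z).2 ⟨by rintro rfl; exact h1 hz.2, hz.1, h3.1 hz.2⟩) (by
      intro X hX
      obtain ⟨hX, h1, h2⟩ := Finset.mem_filter.1 hX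
      have h3 := Finset.mem_powersetCard.1 (hF hX)
      rw [Finset.mem_powersetCard]
      refine ⟨fun z hz => ?_, h3.2⟩
      exact (hmW z).2 ⟨by rintro rfl; exact h1 hz, by rintro rfl; exact h2 hz, h3.1 hz⟩) (by
      intro Y hY
      obtain ⟨X, hX, h1, h2, rfl⟩ := md Y hY
      have h3 := Finset.mem_powersetCard.1 (hF hX)
      rw [Finset.mem_powersetCard, Finset.card_erase_of_mem (Finset.mem_erase.2 ⟨hij.symm, h2⟩),
        Finset.card_erase_of_mem h1, h3.2]
      refine ⟨fun z hz => ?_, by omega⟩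
      rw [Finset.mem_erase, Finset.mem_erase] at hz
      exact (hmW z).2 ⟨hz.2.1, hz.1, h3.1 hz.2.2⟩) (by
      intro Y hY X hX
      obtain ⟨P, hP, h1, h2, rfl⟩ := ma Y hY
      obtain ⟨Q, hQ, h3, h4, rfl⟩ := mb X hX
      obtain ⟨z, hz⟩ := hI P hP Q hQ
      rw [Finset.mem_inter] at hz
      refine ⟨z, ?_⟩
      rw [Finset.mem_inter, Finset.mem_erase, Finset.mem_erase]
      exact ⟨⟨by rintro rfl; exact h3 hz.2, hz.1⟩, by rintro rfl; exact h2 hz.1, hz.2⟩) (by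
      intro Y hY X hX
      obtain ⟨P, hP, h1, h2, rfl⟩ := md Y hY
      obtain ⟨hX, h3, h4⟩ := Finset.mem_filter.1 hX
      obtain ⟨z, hz⟩ := hI P hP X hX
      rw [Finset.mem_inter] at hz
      refine ⟨z, ?_⟩
      rw [Finset.mem_inter, Finset.mem_erase, Finset.mem_erase]
      exact ⟨⟨by rintro rfl; exact h4 hz.2, by rintro rfl; exact h3 hz.2, hz.1⟩, hz.2⟩)
      (by rw [hac, hbc]; exact hle)
      (by rw [hW, show n - 2 - 2 = n - 4 by omega]; omega) (by rw [hW]; omega)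
  rw [hW, show n - 2 - 1 = n - 3 by omega] at key
  omega

theorem four_bound (n k : ℕ) (F : Finset (Finset ℕ)) (i j : ℕ) (hk : 5 ≤ k) (hn : 2 * k < n)
    (hF : F ⊆ Finset.powersetCard k (Finset.Icc 1 n)) (hI : IntF F)
    (hi : i ∈ Finset.Icc 1 n) (hj : j ∈ Finset.Icc 1 n) (hij : i ≠ j)
    (hc : (F.filter (fun X => i ∉ X ∧ j ∉ X)).card ≤ n - k - 1)
    (hgi : (n - 4).choose (k - 3) ≤ (F.filter (fun X => i ∉ X)).card)
    (hgj : (n - 4).choose (k - 3) ≤ (F.filter (fun X => j ∉ X)).card) :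
    F.card ≤ 2 * (n - 3).choose (k - 2) + (n - 2).choose (k - 2) := by
  rcases le_total (F.filter (fun X => i ∉ X ∧ j ∈ X)).card
    (F.filter (fun X => i ∈ X ∧ j ∉ X)).card with h | h
  · exact four_bound_aux n k F i j hk hn hF hI hi hj hij hc hgi h
  · refine four_bound_aux n k F j i hk hn hF hI hj hi hij.symm ?_ hgj ?_
    · simpa only [and_comm] using hc
    · simpa only [and_comm] using h

theorem H_lt_J (n k : ℕ) (hk : 5 ≤ k) (hn : 2 * k < n) :
    2 * (n - 3).choose (k - 2) + (n - 2).choose (k - 2) + 2 * (n - 1 - k).choose (k - 1)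
      < (n - 1).choose (k - 1) + (n - 1 - k - 2).choose (k - 1) + 2 := by
  have h := hArith (n - 1) k hk (by omega)
  obtain ⟨y, hy⟩ : ∃ y, n = y + 4 := ⟨n - 4, by omega⟩
  obtain ⟨j, hj⟩ : ∃ j, k = j + 3 := ⟨k - 3, by omega⟩
  have pas : (n - 1).choose (k - 1) + (n - 4).choose (k - 3)
      = 2 * (n - 3).choose (k - 2) + (n - 2).choose (k - 2) + (n - 4).choose (k - 1) := by
    rw [hy, hj, show y + 4 - 4 = y by omega, show y + 4 - 3 = y + 1 by omega,
      show y + 4 - 2 = y + 2 by omega, show y + 4 - 1 = y + 3 by omega,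
      show j + 3 - 1 = j + 2 by omega, show j + 3 - 2 = j + 1 by omega,
      show j + 3 - 3 = j by omega]
    have p1 := Nat.choose_succ_succ (y + 1) (j + 1)
    have p2 := Nat.choose_succ_succ y (j + 1)
    have p3 := Nat.choose_succ_succ y j
    have p4 := Nat.choose_succ_succ (y + 2) (j + 1)
    simp only [Nat.succ_eq_add_one, add_assoc, Nat.reduceAdd] at p1 p2 p3 p4
    omega
  rw [show n - 1 - 3 = n - 4 by omega] at h
  omega

theorem regime2 (n k : ℕ) (hk : 5 ≤ k) (hn : 2 * k < n) (N : ℕ) : ∀ F : Finset (Finset ℕ),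
    ∑ X ∈ F, ∑ x ∈ X, x = N → F ⊆ Finset.powersetCard k (Finset.Icc 1 n) → IntF F →
    (∀ x ∈ Finset.Icc 1 n, (n - 4).choose (k - 3) ≤ (F.filter (fun X => x ∉ X)).card) →
    F.card + 2 * (n - 1 - k).choose (k - 1)
      < (n - 1).choose (k - 1) + (n - 1 - k - 2).choose (k - 1) + 2 := by
  induction N using Nat.strong_induction_on with
  | _ N ih =>
  intro F hN hF hI hg
  have hHJ := H_lt_J n k hk hn
  by_cases hS : ShiftedF F
  · have := shifted_bound n k F (by omega) (by omega) hF hI hS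
      (hg 1 (Finset.mem_Icc.2 ⟨le_rfl, by omega⟩))
    omega
  · unfold ShiftedF at hS
    push Not at hS
    obtain ⟨X, hX, i, j, h1i, hij, hjX, hiX, hnF⟩ := hS
    have hjn := (Finset.mem_powersetCard.1 (hF hX)).1 hjX
    have hin : i ∈ Finset.Icc 1 n := by rw [Finset.mem_Icc] at *; omega
    set F2 := F.image (tauS F i j) with hF2
    have hc2 : F2.card = F.card := Finset.card_image_of_injOn (tau_inj F i j hij.ne)
    have hs2 : F2 ⊆ _ := tau_sub n k F i j hin hF
    have hI2 : IntF F2 := tau_int F i j hI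
    have hw := tau_weight F i j hij X hX hjX hiX hnF
    by_cases hall : ∀ x ∈ Finset.Icc 1 n,
        (n - 4).choose (k - 3) ≤ (F2.filter (fun X => x ∉ X)).card
    · have := ih _ (hN ▸ hw) F2 rfl hs2 hI2 hall
      omega
    push Not at hall
    obtain ⟨x, hx, hxg⟩ := hall
    have hxi : x = i := by
      by_contra hne
      have : (F.filter (fun X => x ∉ X)).card ≤ (F2.filter (fun X => x ∉ X)).card := by
        apply Finset.card_le_card_of_injOn (tauS F i j)
        · intro Y hY
          have hY := Finset.mem_filter.1 (Finset.mem_coe.1 hY)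
          refine Finset.mem_coe.2 (Finset.mem_filter.2 ⟨Finset.mem_image_of_mem _ hY.1, ?_⟩)
          unfold tauS
          split_ifs
          · simp [hne, hY.2]
          · exact hY.2
        · intro Y hY Z hZ
          exact tau_inj F i j hij.ne (Finset.mem_filter.1 (Finset.mem_coe.1 hY)).1
            (Finset.mem_filter.1 (Finset.mem_coe.1 hZ)).1
      have := hg x hx
      omega
    subst hxi
    have hcsub : F.filter (fun X => x ∉ X ∧ j ∉ X) ⊆ F2.filter (fun X => x ∉ X) := by
      intro Y hY
      obtain ⟨h1, h2, h3⟩ := Finset.mem_filter.1 hY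
      refine Finset.mem_filter.2 ⟨Finset.mem_image.2 ⟨Y, h1, ?_⟩, h2⟩
      unfold tauS
      rw [if_neg (by tauto)]
    have fin : (F.filter (fun X => x ∉ X ∧ j ∉ X)).card ≤ n - k - 1 →
      F.card + 2 * (n - 1 - k).choose (k - 1)
      < (n - 1).choose (k - 1) + (n - 1 - k - 2).choose (k - 1) + 2 := by
      intro h
      have := four_bound n k F x j hk hn hF hI hx hjn hij.ne h (hg x hx) (hg j hjn)
      omega
    rcases regime1F n k F2 x hk hn hs2 hI2 hx hxg with ⟨K, hK1, hK2, hK3⟩ | ⟨B1, B2, h1, h2, h3⟩ | h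
    · apply fin
      by_cases hjK : j ∈ K
      · have : F.filter (fun X => x ∉ X ∧ j ∉ X) = ∅ := by
          apply Finset.eq_empty_of_forall_notMem
          intro Y hY
          have h := Finset.mem_filter.1 (hcsub hY)
          exact (Finset.mem_filter.1 hY).2.2 (hK3 Y h.1 h.2 hjK)
        rw [this]; simp
      · have hW : (((Finset.Icc 1 n).erase x).erase j).card = n - 2 := by
          rw [Finset.card_erase_of_mem (Finset.mem_erase.2 ⟨hij.ne', hjn⟩),
            Finset.card_erase_of_mem hx]
          simp; omega
        have := star_card (F.filter (fun X => x ∉ X ∧ j ∉ X)) (((Finset.Icc 1 n).erase x).erase j)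
          K k (by omega) (by
            intro Y hY
            obtain ⟨h1, h2, h3⟩ := Finset.mem_filter.1 hY
            have h4 := Finset.mem_powersetCard.1 (hF h1)
            exact ⟨Finset.subset_erase.2 ⟨Finset.subset_erase.2 ⟨h4.1, h2⟩, h3⟩, h4.2⟩) hK2 (by
            intro Y hY
            have h := Finset.mem_filter.1 (hcsub hY)
            exact hK3 Y h.1 h.2)
        rw [Finset.card_sdiff_of_subset (Finset.subset_erase.2 ⟨hK1, hjK⟩), hW, hK2] at this
        omega
    · apply fin
      have := Finset.card_le_card hcsub
      rw [h2] at this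
      have := this.trans Finset.card_le_two
      omega
    · omega


theorem perm_of_labels (S : Finset ℕ) (p q : ℕ → ℕ)
    (h : ∀ t, (S.filter (fun x => p x = t)).card = (S.filter (fun x => q x = t)).card) :
    ∃ σ : Equiv.Perm ℕ, (∀ x ∈ S, σ x ∈ S) ∧ ∀ x ∈ S, q (σ x) = p x := by
  have hc : ∀ (r : ℕ → ℕ) (t : ℕ), Fintype.card {x : S // r x = t}
      = (S.filter (fun x => r x = t)).card := by
    intro r t
    rw [← Fintype.card_coe]
    apply Fintype.card_congr
    exact (Equiv.subtypeSubtypeEquivSubtypeInter (fun x => x ∈ S) (fun x => r x = t)).trans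
      (Equiv.subtypeEquivRight (by intro x; simp))
  have he : ∀ t, Nonempty ({x : S // p x = t} ≃ {x : S // q x = t}) := by
    intro t
    exact ⟨Fintype.equivOfCardEq (by rw [hc p t, hc q t, h t])⟩
  let e := fun t => (he t).some
  let E : S ≃ S := (Equiv.sigmaFiberEquiv (fun x : S => p x)).symm.trans
    ((Equiv.sigmaCongrRight e).trans (Equiv.sigmaFiberEquiv (fun x : S => q x)))
  have hE : ∀ x : S, q (E x) = p x := by
    intro x
    exact (e (p x) ⟨x, rfl⟩).2
  refine ⟨Equiv.Perm.ofSubtype E, ?_, ?_⟩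
  · intro x hx
    rw [Equiv.Perm.ofSubtype_apply_of_mem E hx]
    exact (E ⟨x, hx⟩).2
  · intro x hx
    rw [Equiv.Perm.ofSubtype_apply_of_mem E hx]
    exact hE ⟨x, hx⟩

def lab (x : ℕ) (B1 B2 : Finset ℕ) (z : ℕ) : ℕ :=
  if z = x then 0 else if z ∈ B1 then (if z ∈ B2 then 1 else 2) else (if z ∈ B2 then 3 else 4)

theorem lab_count (S : Finset ℕ) (k s x : ℕ) (B1 B2 : Finset ℕ) (hx : x ∈ S) (h1 : B1 ⊆ S)
    (h2 : B2 ⊆ S) (hx1 : x ∉ B1) (hx2 : x ∉ B2) (c1 : B1.card = k) (c2 : B2.card = k)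
    (cs : (B1 ∩ B2).card = s) (t : ℕ) :
    (S.filter (fun z => lab x B1 B2 z = t)).card =
      if t = 0 then 1 else if t = 1 then s else if t = 2 then k - s else if t = 3 then k - s
      else if t = 4 then S.card - 1 - (k + k - s) else 0 := by
  have e0 : S.filter (fun z => lab x B1 B2 z = 0) = {x} := by
    ext z; rw [Finset.mem_filter]; simp only [Finset.mem_singleton]; unfold lab
    split_ifs <;> simp_all
  have e1 : S.filter (fun z => lab x B1 B2 z = 1) = B1 ∩ B2 := by
    ext z; rw [Finset.mem_filter]; simp only [Finset.mem_inter]; unfold lab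
    have := @h1 z
    split_ifs <;> simp_all
  have e2 : S.filter (fun z => lab x B1 B2 z = 2) = B1 \ B2 := by
    ext z; rw [Finset.mem_filter]; simp only [Finset.mem_sdiff]; unfold lab
    have := @h1 z
    split_ifs <;> simp_all
  have e3 : S.filter (fun z => lab x B1 B2 z = 3) = B2 \ B1 := by
    ext z; rw [Finset.mem_filter]; simp only [Finset.mem_sdiff]; unfold lab
    have := @h2 z
    split_ifs <;> simp_all
  have e4 : S.filter (fun z => lab x B1 B2 z = 4) = (S.erase x) \ (B1 ∪ B2) := by
    ext z; rw [Finset.mem_filter]; simp only [Finset.mem_sdiff, Finset.mem_erase, Finset.mem_union]; unfold lab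
    split_ifs <;> simp_all
  have e5 : 5 ≤ t → S.filter (fun z => lab x B1 B2 z = t) = ∅ := by
    intro ht
    apply Finset.filter_eq_empty_iff.2
    intro z _
    unfold lab
    split_ifs <;> omega
  have u := Finset.card_union_add_card_inter B1 B2
  have i2 := Finset.card_sdiff_add_card_inter B1 B2
  have i3 := Finset.card_sdiff_add_card_inter B2 B1
  rw [Finset.inter_comm B2 B1] at i3
  have hsub : B1 ∪ B2 ⊆ S.erase x :=
    Finset.union_subset (Finset.subset_erase.2 ⟨h1, hx1⟩) (Finset.subset_erase.2 ⟨h2, hx2⟩)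
  have i4 := Finset.card_sdiff_of_subset hsub
  rw [Finset.card_erase_of_mem hx] at i4
  rcases Nat.lt_or_ge t 5 with ht | ht
  · interval_cases t
    · rw [e0]; simp
    · rw [e1]; simpa using cs
    · rw [e2]; simp; omega
    · rw [e3]; simp; omega
    · rw [e4, i4]; simp; omega
  · rw [e5 ht, if_neg (by omega), if_neg (by omega), if_neg (by omega), if_neg (by omega),
      if_neg (by omega)]
    simp

theorem lab_x (x : ℕ) (B1 B2 : Finset ℕ) (z : ℕ) : lab x B1 B2 z = 0 ↔ z = x := by
  unfold lab
  split_ifs <;> simp_all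

theorem lab_1 (x : ℕ) (B1 B2 : Finset ℕ) (z : ℕ) (h : x ∉ B1) :
    (lab x B1 B2 z = 1 ∨ lab x B1 B2 z = 2) ↔ z ∈ B1 := by
  unfold lab
  split_ifs <;> simp_all

theorem lab_2 (x : ℕ) (B1 B2 : Finset ℕ) (z : ℕ) (h : x ∉ B2) :
    (lab x B1 B2 z = 1 ∨ lab x B1 B2 z = 3) ↔ z ∈ B2 := by
  unfold lab
  split_ifs <;> simp_all

def Jgen (n k x : ℕ) (B1 B2 : Finset ℕ) : Finset (Finset ℕ) :=
  {B1, B2} ∪ (Finset.powersetCard k (Finset.Icc 1 n)).filter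
      (fun A => x ∈ A ∧ (A ∩ B1).Nonempty ∧ (A ∩ B2).Nonempty)

theorem Jgen_iso (n k s x y : ℕ) (B1 B2 C1 C2 : Finset ℕ)
    (hx : x ∈ Finset.Icc 1 n) (h1 : B1 ⊆ Finset.Icc 1 n)
    (h2 : B2 ⊆ Finset.Icc 1 n) (hx1 : x ∉ B1) (hx2 : x ∉ B2) (b1 : B1.card = k) (b2 : B2.card = k)
    (bs : (B1 ∩ B2).card = s)
    (hy : y ∈ Finset.Icc 1 n) (g1 : C1 ⊆ Finset.Icc 1 n)
    (g2 : C2 ⊆ Finset.Icc 1 n) (hy1 : y ∉ C1) (hy2 : y ∉ C2) (c1 : C1.card = k) (c2 : C2.card = k)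
    (cs : (C1 ∩ C2).card = s) :
    Isomorphic n (Jgen n k x B1 B2) (Jgen n k y C1 C2) := by
  set S := Finset.Icc 1 n with hS
  obtain ⟨σ, hσ1, hσ2⟩ := perm_of_labels S (lab x B1 B2) (lab y C1 C2) (by
    intro t
    rw [lab_count S k s x B1 B2 hx h1 h2 hx1 hx2 b1 b2 bs,
      lab_count S k s y C1 C2 hy g1 g2 hy1 hy2 c1 c2 cs])
  have kx : ∀ z ∈ S, (z = x ↔ σ z = y) := by
    intro z hz
    rw [← lab_x x B1 B2 z, ← hσ2 z hz, lab_x]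
  have k1 : ∀ z ∈ S, (z ∈ B1 ↔ σ z ∈ C1) := by
    intro z hz
    rw [← lab_1 x B1 B2 z hx1, ← hσ2 z hz, lab_1 _ _ _ _ hy1]
  have k2 : ∀ z ∈ S, (z ∈ B2 ↔ σ z ∈ C2) := by
    intro z hz
    rw [← lab_2 x B1 B2 z hx2, ← hσ2 z hz, lab_2 _ _ _ _ hy2]
  have hSS : S.image σ = S := by
    apply Finset.eq_of_subset_of_card_le
    · intro z hz
      obtain ⟨w, hw, rfl⟩ := Finset.mem_image.1 hz
      exact hσ1 w hw
    · rw [Finset.card_image_of_injective _ σ.injective]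
  have ic : ∀ A : Finset ℕ, (A.image σ).card = A.card :=
    fun A => Finset.card_image_of_injective _ σ.injective
  have e1 : B1.image σ = C1 := by
    apply Finset.eq_of_subset_of_card_le
    · intro z hz
      obtain ⟨w, hw, rfl⟩ := Finset.mem_image.1 hz
      exact (k1 w (h1 hw)).1 hw
    · rw [ic, b1, c1]
  have e2 : B2.image σ = C2 := by
    apply Finset.eq_of_subset_of_card_le
    · intro z hz
      obtain ⟨w, hw, rfl⟩ := Finset.mem_image.1 hz
      exact (k2 w (h2 hw)).1 hw
    · rw [ic, b2, c2]
  have ex : σ x = y := (kx x hx).1 rfl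
  have hin : ∀ A B : Finset ℕ, ((A.image σ) ∩ (B.image σ)).Nonempty ↔ (A ∩ B).Nonempty := by
    intro A B
    rw [← Finset.image_inter _ _ σ.injective, Finset.image_nonempty]
  refine ⟨σ, hσ1, ?_⟩
  unfold Jgen
  rw [Finset.image_union]
  congr 1
  · rw [Finset.image_insert, Finset.image_singleton, e1, e2]
  · ext A
    simp only [Finset.mem_image, Finset.mem_filter, Finset.mem_powersetCard]
    constructor
    · rintro ⟨Z, ⟨⟨q1, q2⟩, q3, q4, q5⟩, rfl⟩
      refine ⟨⟨?_, by rw [ic, q2]⟩, ?_, ?_, ?_⟩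
      · rw [← hS, ← hSS]; exact Finset.image_subset_image q1
      · rw [← ex]; exact Finset.mem_image_of_mem _ q3
      · rw [← e1, hin]; exact q4
      · rw [← e2, hin]; exact q5
    · rintro ⟨⟨q1, q2⟩, q3, q4, q5⟩
      have hA : (A.image σ.symm).image σ = A := by
        rw [Finset.image_image]; simp
      refine ⟨A.image σ.symm, ⟨⟨?_, ?_⟩, ?_, ?_, ?_⟩, hA⟩
      · intro z hz
        obtain ⟨w, hw, rfl⟩ := Finset.mem_image.1 hz
        have : w ∈ S.image σ := by rw [hSS]; exact q1 hw
        obtain ⟨u, hu, rfl⟩ := Finset.mem_image.1 this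
        rw [Equiv.symm_apply_apply]; exact hu
      · rw [← ic, hA, q2]
      · rw [← hA, ← ex] at q3
        obtain ⟨w, hw, hw2⟩ := Finset.mem_image.1 q3
        rw [← σ.injective hw2]; exact hw
      · rw [← hin, hA, e1]; exact q4
      · rw [← hin, hA, e2]; exact q5

theorem Jgen_card (n k s x : ℕ) (B1 B2 : Finset ℕ) (hk : 1 ≤ k)
    (hx : x ∈ Finset.Icc 1 n) (h1 : B1 ⊆ Finset.Icc 1 n)
    (h2 : B2 ⊆ Finset.Icc 1 n) (hx1 : x ∉ B1) (hx2 : x ∉ B2) (b1 : B1.card = k) (b2 : B2.card = k)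
    (bs : (B1 ∩ B2).card = s) (hne : B1 ≠ B2) :
    (Jgen n k x B1 B2).card + 2 * (n - 1 - k).choose (k - 1)
      = (n - 1).choose (k - 1) + (n - 1 - (2 * k - s)).choose (k - 1) + 2 := by
  set V := (Finset.Icc 1 n).erase x with hVd
  have hV : V.card = n - 1 := by
    rw [hVd, Finset.card_erase_of_mem hx]; simp
  have hD := DM_card V B1 B2 k (Finset.subset_erase.2 ⟨h1, hx1⟩)
    (Finset.subset_erase.2 ⟨h2, hx2⟩) b1 b2
  rw [hV, bs] at hD
  set D := shq (k - 1) (coV V {B1, B2}) with hDd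
  have hDsub : D ⊆ Finset.powersetCard (k - 1) V := by
    intro Y hY
    rw [hDd, mem_shq_coV] at hY
    obtain ⟨X, _, q1, _, q2⟩ := hY
    exact Finset.mem_powersetCard.2 ⟨q1, q2⟩
  have hDc := Finset.card_sdiff_add_card_eq_card hDsub
  rw [Finset.card_powersetCard, hV] at hDc
  have hmD : ∀ Y ⊆ V, Y.card = k - 1 → (Y ∉ D ↔ (Y ∩ B1).Nonempty ∧ (Y ∩ B2).Nonempty) := by
    intro Y q1 q2
    rw [hDd, mem_shq_coV, ← Finset.not_disjoint_iff_nonempty_inter,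
      ← Finset.not_disjoint_iff_nonempty_inter]
    simp [q1, q2]
  have hstar : ((Finset.powersetCard k (Finset.Icc 1 n)).filter
      (fun A => x ∈ A ∧ (A ∩ B1).Nonempty ∧ (A ∩ B2).Nonempty)).card
      = (Finset.powersetCard (k - 1) V \ D).card := by
    rw [← erase_card _ x (fun X hX => (Finset.mem_filter.1 hX).2.1)]
    congr 1
    have hee : ∀ (A B : Finset ℕ), x ∉ B → A.erase x ∩ B = A ∩ B := by
      intro A B hB
      ext z
      simp only [Finset.mem_inter, Finset.mem_erase]
      constructor
      · tauto
      · rintro ⟨r1, r2⟩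
        exact ⟨⟨by rintro rfl; exact hB r2, r1⟩, r2⟩
    ext Y
    simp only [Finset.mem_image, Finset.mem_filter, Finset.mem_powersetCard, Finset.mem_sdiff]
    constructor
    · rintro ⟨A, ⟨⟨q1, q2⟩, q3, q4, q5⟩, rfl⟩
      have r1 : A.erase x ⊆ V := Finset.erase_subset_erase _ q1
      have r2 : (A.erase x).card = k - 1 := by rw [Finset.card_erase_of_mem q3, q2]
      refine ⟨⟨r1, r2⟩, (hmD _ r1 r2).2 ?_⟩
      rw [hee _ _ hx1, hee _ _ hx2]
      exact ⟨q4, q5⟩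
    · rintro ⟨⟨q1, q2⟩, q3⟩
      have hxY : x ∉ Y := (Finset.subset_erase.1 q1).2
      rw [hmD Y q1 q2] at q3
      refine ⟨insert x Y, ⟨⟨?_, ?_⟩, ?_, ?_, ?_⟩, Finset.erase_insert hxY⟩
      · exact Finset.insert_subset hx (Finset.subset_erase.1 q1).1
      · rw [Finset.card_insert_of_notMem hxY, q2]; omega
      · simp
      · exact q3.1.mono (Finset.inter_subset_inter_right (Finset.subset_insert _ _))
      · exact q3.2.mono (Finset.inter_subset_inter_right (Finset.subset_insert _ _))
  have hJ : (Jgen n k x B1 B2).card = 2 + (Finset.powersetCard (k - 1) V \ D).card := by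
    unfold Jgen
    rw [Finset.card_union_of_disjoint, hstar, Finset.card_pair hne]
    rw [Finset.disjoint_left]
    intro A hA hA2
    have := (Finset.mem_filter.1 hA2).2.1
    simp only [Finset.mem_insert, Finset.mem_singleton] at hA
    rcases hA with rfl | rfl
    · exact hx1 this
    · exact hx2 this
  omega

theorem Iset_facts (n k i : ℕ) (hk : 5 ≤ k) (hn : 2 * k < n) (h1 : 1 ≤ i) (h2 : i ≤ k) :
    Iset k i ⊆ Finset.Icc 1 n ∧ 1 ∉ Iset k i ∧ (Iset k i).card = k ∧
      (Iset k 1 ∩ Iset k i).card = k + 1 - i := by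
  refine ⟨?_, ?_, ?_, ?_⟩
  · intro z hz
    rw [Iset, Finset.mem_Icc] at hz
    rw [Finset.mem_Icc]; omega
  · rw [Iset, Finset.mem_Icc]; omega
  · rw [Iset, Nat.card_Icc]; omega
  · have : Iset k 1 ∩ Iset k i = Finset.Icc (i + 1) (k + 1) := by
      ext z
      simp only [Iset, Finset.mem_inter, Finset.mem_Icc]
      omega
    rw [this, Nat.card_Icc]; omega

theorem choose_strict (a b r : ℕ) (hr : 1 ≤ r) (hab : a < b) (hrb : r ≤ b) :
    a.choose r < b.choose r := by
  obtain ⟨b', rfl⟩ : ∃ b', b = b' + 1 := ⟨b - 1, by omega⟩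
  obtain ⟨r', rfl⟩ : ∃ r', r = r' + 1 := ⟨r - 1, by omega⟩
  have h1 := Nat.choose_le_choose (r' + 1) (show a ≤ b' by omega)
  have h2 := Nat.choose_pos (show r' ≤ b' by omega)
  rw [Nat.choose_succ_succ]
  simp only [Nat.succ_eq_add_one]
  omega

theorem stmt11 (n k : ℕ) (hk : 10 ≤ 2 * k) (hn : 2 * k < n)
    (F : Finset (Finset ℕ)) (hF : F ⊆ Finset.powersetCard k (Finset.Icc 1 n))
    (hint : Intersecting F) (hcard : F.card = (Jfam n k 3).card)
    (hnotE : ¬ ∃ i ∈ Finset.Icc 1 n, ∃ K : Finset ℕ,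
      K ⊆ (Finset.Icc 1 n).erase i ∧ K.card = k - 1 ∧
        ∀ A ∈ F, i ∈ A ∨ K ⊆ A) :
    (2 * k + 2 ≤ n → Isomorphic n F (Jfam n k 3)) ∧
      (n = 2 * k + 1 → ∃ i : ℕ, 3 ≤ i ∧ i ≤ k ∧ Isomorphic n F (Jfam n k i)) := by
  have hk5 : 5 ≤ k := by omega
  have hI : IntF F := (hint)
  have hJ : ∀ i, Jfam n k i = Jgen n k 1 (Iset k 1) (Iset k i) := fun i => rfl
  have h1n : 1 ∈ Finset.Icc 1 n := Finset.mem_Icc.2 ⟨le_rfl, by omega⟩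
  obtain ⟨p1, p2, p3, -⟩ := Iset_facts n k 1 hk5 hn le_rfl (by omega)
  obtain ⟨q1, q2, q3, q4⟩ := Iset_facts n k 3 hk5 hn (by omega) (by omega)
  have hJc := Jgen_card n k (k + 1 - 3) 1 (Iset k 1) (Iset k 3) (by omega) h1n p1 q1 p2 q2 p3 q3 q4
    (by
      intro h
      rw [← h, Finset.inter_self, p3] at q4
      omega)
  rw [← hJ, ← hcard, show n - 1 - (2 * k - (k + 1 - 3)) = n - 1 - k - 2 by omega] at hJc
  by_cases hall : ∀ x ∈ Finset.Icc 1 n, (n - 4).choose (k - 3) ≤ (F.filter (fun X => x ∉ X)).card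
  · have := regime2 n k hk5 hn _ F rfl hF hI hall
    omega
  push Not at hall
  obtain ⟨x, hx, hxg⟩ := hall
  rcases regime1F n k F x hk5 hn hF hI hx hxg with ⟨K, hK1, hK2, hK3⟩ | ⟨B1, B2, hne, hB, hs⟩ | h
  · exfalso
    apply hnotE
    refine ⟨x, hx, K, hK1, hK2, fun A hA => ?_⟩
    by_cases hxA : x ∈ A
    · exact Or.inl hxA
    · exact Or.inr (hK3 A hA hxA)
  swap
  · omega
  have m1 : B1 ∈ F.filter (fun X => x ∉ X) := by rw [hB]; simp
  have m2 : B2 ∈ F.filter (fun X => x ∉ X) := by rw [hB]; simp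
  obtain ⟨m1, hx1⟩ := Finset.mem_filter.1 m1
  obtain ⟨m2, hx2⟩ := Finset.mem_filter.1 m2
  obtain ⟨s1, b1⟩ := Finset.mem_powersetCard.1 (hF m1)
  obtain ⟨s2, b2⟩ := Finset.mem_powersetCard.1 (hF m2)
  have hspos : 1 ≤ (B1 ∩ B2).card := Finset.card_pos.2 (hI B1 m1 B2 m2)
  have hsub : F ⊆ Jgen n k x B1 B2 := by
    intro A hA
    unfold Jgen
    by_cases hxA : x ∈ A
    · exact Finset.mem_union_right _ (Finset.mem_filter.2 ⟨hF hA, hxA, hI A hA B1 m1, hI A hA B2 m2⟩)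
    · refine Finset.mem_union_left _ ?_
      rw [← hB]; exact Finset.mem_filter.2 ⟨hA, hxA⟩
  have hc2 := Jgen_card n k _ x B1 B2 (by omega) hx s1 s2 hx1 hx2 b1 b2 rfl hne
  have hle := Finset.card_le_card hsub
  have hmono := Nat.choose_le_choose (k - 1)
    (show n - 1 - (2 * k - (B1 ∩ B2).card) ≤ n - 1 - k - 2 by omega)
  have hEq : F = Jgen n k x B1 B2 := Finset.eq_of_subset_of_card_le hsub (by omega)
  have iso : ∀ i, 3 ≤ i → i ≤ k → (B1 ∩ B2).card = k + 1 - i → Isomorphic n F (Jfam n k i) := by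
    intro i hi1 hi2 hi3
    obtain ⟨r1, r2, r3, r4⟩ := Iset_facts n k i hk5 hn (by omega) hi2
    rw [hEq, hJ]
    exact Jgen_iso n k _ x 1 B1 B2 _ _ hx s1 s2 hx1 hx2 b1 b2 hi3 h1n p1 r1 p2 r2 p3 r3 r4
  constructor
  · intro hn2
    apply iso 3 le_rfl (by omega)
    by_contra hcon
    have := choose_strict (n - 1 - (2 * k - (B1 ∩ B2).card)) (n - 1 - k - 2) (k - 1) (by omega)
      (by omega) (by omega)
    omega
  · intro _
    exact ⟨k + 1 - (B1 ∩ B2).card, by omega, by omega,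
      iso _ (by omega) (by omega) (by omega)⟩
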